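/- arXiv:2402.13416 — 14 statements merged into one kernel-verified Lean document; each statement's English description precedes it below -/
import Mathlib

section
/- Let X be a normed space over 𝔽 ∈ {ℝ, ℂ} of finite dimension n ≥ 1. Then n equals the minimal cardinality of a finite subset Ω of X such that ⋂_{x ∈ Ω} x^⊥ = {0}; that is, there exists a subset Ω of X with exactly n elements satisfying ⋂_{x ∈ Ω} x^⊥ = {0}, and for every finite subset Ω of X with fewer than n elements the intersection ⋂_{x ∈ Ω} x^⊥ contains a nonzero vector. -/
/-- Birkhoff–James orthogonality: `x ⊥ y` iff `‖x + c • y‖ ≥ ‖x‖` for all scalars `c`. -/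
def BJOrtho (𝕜 : Type*) [RCLike 𝕜] {X : Type*} [NormedAddCommGroup X] [NormedSpace 𝕜 X]
    (x y : X) : Prop :=
  ∀ c : 𝕜, ‖x‖ ≤ ‖x + c • y‖

theorem BJOrtho.of_dual_apply_eq_zero {𝕜 X : Type*} [RCLike 𝕜] [NormedAddCommGroup X]
    [NormedSpace 𝕜 X] {x y : X} {f : StrongDual 𝕜 X} (hf : ‖f‖ ≤ 1) (hx : f x = ‖x‖)
    (hy : f y = 0) : BJOrtho 𝕜 x y := by
  intro c
  have h := f.le_of_opNorm_le hf (x + c • y)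
  simpa [hx, hy] using h

theorem isClosed_setOf_bjOrtho (𝕜 : Type*) {X : Type*} [RCLike 𝕜] [NormedAddCommGroup X]
    [NormedSpace 𝕜 X] (y : X) : IsClosed {x : X | BJOrtho 𝕜 x y} := by
  simp only [BJOrtho, Set.ofPred_forall]
  exact isClosed_iInter fun c => isClosed_le (by fun_prop) (by fun_prop)

theorem bjOrtho_self_iff {𝕜 X : Type*} [RCLike 𝕜] [NormedAddCommGroup X] [NormedSpace 𝕜 X]
    {x : X} : BJOrtho 𝕜 x x ↔ x = 0 := by
  refine ⟨fun h => ?_, fun h c => by simp [h]⟩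
  simpa using h (-1)

/-- The derivative of the norm at `x` is the real part of any norming functional of `x`. -/
theorem HasFDerivAt.norm_eq_re_dual {𝕜 X : Type*} [RCLike 𝕜] [NormedAddCommGroup X]
    [NormedSpace 𝕜 X] [NormedSpace ℝ X] [IsScalarTower ℝ 𝕜 X] {x : X} {L : X →L[ℝ] ℝ}
    (hL : HasFDerivAt (‖·‖) L x) {f : StrongDual 𝕜 X} (hf : ‖f‖ ≤ 1) (hx : f x = ‖x‖) (v : X) :
    L v = RCLike.re (f v) := by
  have hre : HasFDerivAt (fun v => RCLike.re (f v))
      ((RCLike.reCLM : 𝕜 →L[ℝ] ℝ).comp (f.restrictScalars ℝ)) x :=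
    ((RCLike.reCLM : 𝕜 →L[ℝ] ℝ).comp (f.restrictScalars ℝ)).hasFDerivAt
  have hmin : IsLocalMin (fun v => ‖v‖ - RCLike.re (f v)) x := by
    refine Filter.Eventually.of_forall fun v => ?_
    have h := (RCLike.re_le_norm (f v)).trans (f.le_of_opNorm_le hf v)
    simp only [hx, RCLike.ofReal_re]
    linarith
  have h := congrArg (· v) (hmin.hasFDerivAt_eq_zero (hL.sub hre))
  simpa [sub_eq_zero] using h

/-- At a point of differentiability of the norm, Birkhoff–James orthogonality is given by the
kernel of any norming functional. -/
theorem bjOrtho_iff_dual_apply_eq_zero {𝕜 X : Type*} [RCLike 𝕜] [NormedAddCommGroup X]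
    [NormedSpace 𝕜 X] [NormedSpace ℝ X] [IsScalarTower ℝ 𝕜 X] {x : X}
    (hd : DifferentiableAt ℝ (‖·‖) x) {f : StrongDual 𝕜 X} (hf : ‖f‖ ≤ 1) (hx : f x = ‖x‖)
    {y : X} : BJOrtho 𝕜 x y ↔ f y = 0 := by
  refine ⟨fun h => ?_, BJOrtho.of_dual_apply_eq_zero hf hx⟩
  have hre : ∀ c : 𝕜, RCLike.re (f (c • y)) = 0 := by
    intro c
    rw [← hd.hasFDerivAt.norm_eq_re_dual hf hx]
    have hmin : IsLocalMin (fun t : ℝ => ‖x + t • c • y‖) 0 := by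
      refine Filter.Eventually.of_forall fun t => ?_
      simpa [← smul_assoc] using h (t • c)
    exact hmin.hasDerivAt_eq_zero (hd.hasFDerivAt.hasLineDerivAt (c • y))
  have h0 := hre (starRingEnd 𝕜 (f y))
  rw [map_smul, smul_eq_mul, RCLike.conj_mul, ← RCLike.ofReal_pow, RCLike.ofReal_re] at h0
  simpa using h0

/-- The functionals whose kernel is the right orthogonal set of some vector span the dual. -/
theorem span_dual_bjOrtho_eq_top (𝕜 X : Type*) [RCLike 𝕜] [NormedAddCommGroup X]
    [NormedSpace 𝕜 X] [FiniteDimensional 𝕜 X] :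
    Submodule.span 𝕜 {f : Module.Dual 𝕜 X | ∃ x, ∀ y, BJOrtho 𝕜 x y ↔ f y = 0} = ⊤ := by
  let _ : NormedSpace ℝ X := NormedSpace.restrictScalars ℝ 𝕜 X
  have : IsScalarTower ℝ 𝕜 X := RestrictScalars.isScalarTower ℝ 𝕜 X
  have : FiniteDimensional ℝ X := FiniteDimensional.trans ℝ 𝕜 X
  rw [← Subspace.dualCoannihilator_dualAnnihilator_eq (W := Submodule.span 𝕜 _),
    Submodule.dualAnnihilator_eq_top_iff, Submodule.eq_bot_iff]
  intro z hz
  rw [Submodule.mem_dualCoannihilator] at hz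
  have hdense : Dense {x : X | BJOrtho 𝕜 x z} := by
    refine (dense_differentiableAt_norm (E := X)).mono fun x hx => ?_
    obtain ⟨f, hf, hfx⟩ := exists_dual_vector'' 𝕜 x
    have h : ∀ y, BJOrtho 𝕜 x y ↔ f y = 0 := fun y => bjOrtho_iff_dual_apply_eq_zero hx hf hfx
    exact (h z).2 (hz (f : X →ₗ[𝕜] 𝕜) (Submodule.subset_span ⟨x, h⟩))
  have huniv := (isClosed_setOf_bjOrtho 𝕜 z).closure_eq.symm.trans hdense.closure_eq
  exact bjOrtho_self_iff.1 (huniv.ge (Set.mem_univ z))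

/-- In a finite-dimensional normed space `X` over `𝕜 ∈ {ℝ, ℂ}` of dimension `n ≥ 1`,
`n` is the minimal cardinality of a finite subset `Ω ⊆ X` with `⋂_{x ∈ Ω} x^⊥ = {0}`. -/
theorem stmt0 {𝕜 X : Type*} [RCLike 𝕜] [NormedAddCommGroup X] [NormedSpace 𝕜 X]
    [FiniteDimensional 𝕜 X] (hn : 1 ≤ Module.finrank 𝕜 X) :
    (∃ Ω : Finset X, Ω.card = Module.finrank 𝕜 X ∧
      (⋂ x ∈ Ω, {y : X | BJOrtho 𝕜 x y}) = {0}) ∧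
    (∀ Ω : Finset X, Ω.card < Module.finrank 𝕜 X →
      ∃ z : X, z ≠ 0 ∧ z ∈ ⋂ x ∈ Ω, {y : X | BJOrtho 𝕜 x y}) := by
  classical
  constructor
  · have htop := span_dual_bjOrtho_eq_top 𝕜 X
    obtain ⟨f, hfs, hspan, hli⟩ := Submodule.exists_fun_fin_finrank_span_eq 𝕜
      {f : Module.Dual 𝕜 X | ∃ x, ∀ y, BJOrtho 𝕜 x y ↔ f y = 0}
    choose x hx using hfs
    have hinj : Function.Injective x := by
      intro i j hij
      by_contra hne
      have hker : LinearMap.ker (f i) ≤ LinearMap.ker (f j) := by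
        intro y hy
        exact (hx j y).1 (hij ▸ (hx i y).2 hy)
      obtain ⟨c, hc⟩ : ∃ c : 𝕜, f j = c • f i := by
        have h := mem_span_of_iInf_ker_le_ker (L := fun _ : Unit => f i) (K := f j)
          (by simpa using hker)
        simpa [Submodule.mem_span_singleton, eq_comm] using h
      have h := (LinearIndepOn.pair_iff f hne).1 (hli.linearIndepOn _) c (-1) (by simp [hc])
      simp at h
    refine ⟨Finset.univ.image x, ?_, ?_⟩
    · rw [Finset.card_image_of_injective _ hinj, Finset.card_univ, Fintype.card_fin, htop,
        finrank_top, Subspace.dual_finrank_eq]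
    · ext y
      simp only [Finset.mem_image, Finset.mem_univ, true_and, Set.iInter_exists,
        Set.iInter_iInter_eq', Set.mem_iInter, Set.mem_ofPred_eq, Set.mem_singleton_iff, hx]
      refine ⟨fun h => ?_, fun h i => by simp [h]⟩
      rw [← Module.forall_dual_apply_eq_zero_iff 𝕜]
      intro φ
      have hφ : φ ∈ Submodule.span 𝕜 (Set.range f) := by
        rw [hspan, htop]; trivial
      induction hφ using Submodule.span_induction with
      | mem φ hφ => obtain ⟨i, rfl⟩ := hφ; exact h i
      | zero => simp
      | add φ ψ _ _ hφ hψ => simp [hφ, hψ]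
      | smul c φ _ hφ => simp [hφ]
  · intro Ω hΩ
    choose f hf hfx using fun x : X => exists_dual_vector'' 𝕜 x
    let F : X →ₗ[𝕜] (Ω → 𝕜) := LinearMap.pi fun x => (f x : X →ₗ[𝕜] 𝕜)
    have hF : LinearMap.ker F ≠ ⊥ := F.ker_ne_bot_of_finrank_lt (by simpa using hΩ)
    obtain ⟨z, hz, hz0⟩ := (Submodule.ne_bot_iff _).1 hF
    refine ⟨z, hz0, Set.mem_iInter₂.2 fun x hx => ?_⟩
    exact BJOrtho.of_dual_apply_eq_zero (hf x) (hfx x) (congrFun hz ⟨x, hx⟩)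
end

section
/- Let X be a smooth finite-dimensional normed space over 𝔽 ∈ {ℝ, ℂ} and let S be a subset of X. Then the linear span of S equals the intersection ⋂ { x^⊥ : x ∈ X and x ⊥ s for every s ∈ S }. -/
/-- A vector that is a nearest point to the origin in its coset of a submodule has a
supporting functional vanishing on that submodule. -/
theorem exists_supporting_functional_vanishing {𝕜 X : Type*} [RCLike 𝕜] [NormedAddCommGroup X]
    [NormedSpace 𝕜 X] (M : Submodule 𝕜 X) {x : X} (hx : x ≠ 0)
    (h : ∀ m ∈ M, ‖x‖ ≤ ‖x + m‖) :
    ∃ f : X →L[𝕜] 𝕜, (‖f‖ = 1 ∧ f x = (‖x‖ : 𝕜)) ∧ ∀ m ∈ M, f m = 0 := by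
  have hpos : 0 < ‖x‖ := norm_pos_iff.2 hx
  have hnorm : ‖(Submodule.Quotient.mk x : X ⧸ M)‖ = ‖x‖ := by
    refine le_antisymm (Submodule.Quotient.norm_mk_le M x) (le_of_forall_pos_lt_add ?_)
    intro ε hε
    obtain ⟨z, hz, hlt⟩ := Submodule.Quotient.norm_mk_lt (Submodule.Quotient.mk x : X ⧸ M) hε
    have hzx : z - x ∈ M := (Submodule.Quotient.eq M).1 hz
    have := h _ hzx
    rw [add_sub_cancel] at this
    exact this.trans_lt hlt
  obtain ⟨g, hg, hgx⟩ := exists_dual_vector 𝕜 (Submodule.Quotient.mk x : X ⧸ M)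
    (hnorm.trans_ne hpos.ne')
  have hle : ∀ z, ‖g (M.mkQ z)‖ ≤ 1 * ‖z‖ := fun z =>
    (g.le_of_opNorm_le hg.le _).trans (by gcongr; exact Submodule.Quotient.norm_mk_le M z)
  let f : X →L[𝕜] 𝕜 := (g.toLinearMap ∘ₗ M.mkQ).mkContinuous 1 hle
  have hfx : f x = (‖x‖ : 𝕜) := by
    rw [← hnorm]
    exact hgx
  refine ⟨f, ⟨le_antisymm (LinearMap.mkContinuous_norm_le _ zero_le_one _) ?_, hfx⟩, ?_⟩
  · have := f.le_opNorm x
    rw [hfx, RCLike.norm_ofReal, abs_norm] at this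
    exact le_of_mul_le_mul_right (by rwa [one_mul]) hpos
  · intro m hm
    change g (M.mkQ m) = 0
    rw [Submodule.mkQ_apply, (Submodule.Quotient.mk_eq_zero M).2 hm, map_zero]

/-- Characterization due to James: a nonzero vector `x` is BJ-orthogonal to `y` only if some supporting
functional of `x` vanishes at `y`. -/
theorem BJOrtho.exists_supporting_functional {𝕜 X : Type*} [RCLike 𝕜] [NormedAddCommGroup X]
    [NormedSpace 𝕜 X] {x y : X} (hx : x ≠ 0) (h : BJOrtho 𝕜 x y) :
    ∃ f : X →L[𝕜] 𝕜, (‖f‖ = 1 ∧ f x = (‖x‖ : 𝕜)) ∧ f y = 0 := by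
  obtain ⟨f, hf, hfy⟩ := exists_supporting_functional_vanishing (𝕜 ∙ y) hx
    fun m hm => by
      obtain ⟨c, rfl⟩ := Submodule.mem_span_singleton.1 hm
      exact h c
  exact ⟨f, hf, hfy y (Submodule.mem_span_singleton_self y)⟩

/-- A vector is BJ-orthogonal to the kernel of each of its supporting functionals. -/
theorem BJOrtho.of_supporting_functional {𝕜 X : Type*} [RCLike 𝕜] [NormedAddCommGroup X]
    [NormedSpace 𝕜 X] {x y : X} {f : X →L[𝕜] 𝕜} (hf : ‖f‖ = 1) (hfx : f x = (‖x‖ : 𝕜))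
    (hfy : f y = 0) : BJOrtho 𝕜 x y := by
  intro c
  have := f.le_opNorm (x + c • y)
  rwa [map_add, map_smul, hfy, smul_zero, add_zero, hfx, RCLike.norm_ofReal, abs_norm, hf,
    one_mul] at this

/-- A vector outside a submodule of a finite-dimensional space differs from some nonzero
vector BJ-orthogonal to the submodule by an element of the submodule. -/
theorem exists_sub_mem_norm_le_add {𝕜 X : Type*} [RCLike 𝕜] [NormedAddCommGroup X]
    [NormedSpace 𝕜 X] [FiniteDimensional 𝕜 X] (M : Submodule 𝕜 X) {y : X} (hy : y ∉ M) :
    ∃ x : X, x ≠ 0 ∧ y - x ∈ M ∧ ∀ m ∈ M, ‖x‖ ≤ ‖x + m‖ := by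
  have := FiniteDimensional.proper_rclike 𝕜 X
  obtain ⟨w, hw, hdist⟩ :=
    (Submodule.closed_of_finiteDimensional M).exists_infDist_eq_dist ⟨0, M.zero_mem⟩ y
  refine ⟨y - w, sub_ne_zero.2 fun h => hy (h ▸ hw), by simpa using hw, fun m hm => ?_⟩
  have := Metric.infDist_le_dist_of_mem (x := y) (M.sub_mem hw hm)
  rw [hdist, dist_eq_norm, dist_eq_norm] at this
  rwa [sub_add]

/-- In a smooth finite-dimensional normed space, the linear span of a set `S` equals the
intersection of the outgoing BJ-orthogonality neighborhoods `x^⊥` over all `x` that are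
BJ-orthogonal to every element of `S`. -/
theorem stmt1 {𝕜 X : Type*} [RCLike 𝕜] [NormedAddCommGroup X] [NormedSpace 𝕜 X]
    [FiniteDimensional 𝕜 X]
    (hsmooth : ∀ x : X, x ≠ 0 → ∃! f : X →L[𝕜] 𝕜, ‖f‖ = 1 ∧ f x = (‖x‖ : 𝕜))
    (S : Set X) :
    (Submodule.span 𝕜 S : Set X) =
      ⋂ x ∈ {x : X | ∀ s ∈ S, BJOrtho 𝕜 x s}, {y : X | BJOrtho 𝕜 x y} := by
  ext y
  simp only [SetLike.mem_coe, Set.mem_iInter, Set.mem_ofPred_eq]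
  constructor
  · intro hy x hxS
    rcases eq_or_ne x 0 with rfl | hx
    · intro c
      simp
    obtain ⟨f, ⟨hf, hfx⟩, huniq⟩ := hsmooth x hx
    have hspan : Submodule.span 𝕜 S ≤ LinearMap.ker f.toLinearMap := by
      refine Submodule.span_le.2 fun s hs => ?_
      obtain ⟨g, hg, hgs⟩ := (hxS s hs).exists_supporting_functional hx
      obtain rfl := huniq g hg
      exact hgs
    exact BJOrtho.of_supporting_functional hf hfx (hspan hy)
  · intro h
    by_contra hy
    obtain ⟨x, hx, hyx, hxM⟩ := exists_sub_mem_norm_le_add (Submodule.span 𝕜 S) hy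
    have hxy : BJOrtho 𝕜 x y :=
      h x fun s hs c => hxM _ (Submodule.smul_mem _ c (Submodule.subset_span hs))
    obtain ⟨f, hf, hfM⟩ := exists_supporting_functional_vanishing (Submodule.span 𝕜 S) hx hxM
    obtain ⟨g, hg, hgy⟩ := hxy.exists_supporting_functional hx
    obtain rfl := (hsmooth x hx).unique hf hg
    have hfx := hfM _ hyx
    rw [map_sub, hgy, hf.2, zero_sub, neg_eq_zero, RCLike.ofReal_eq_zero, norm_eq_zero] at hfx
    exact hx hfx
end

section
/- Let X be a normed space over 𝔽 ∈ {ℝ, ℂ} of finite dimension n ≥ 1. Then the following are equivalent: (i) there exist a linear bijection A : X → 𝔽ⁿ such that ‖x‖ = ‖Ax‖_∞ for all x ∈ X, where ‖·‖_∞ is the supremum norm on 𝔽ⁿ; (ii) the family of sets { x^⊥ : x ∈ X \ {0} and x is a smooth point } has exactly n elements. -/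
/-- `f` is a supporting functional of `x`. -/
def IsSuppFun (𝕜 : Type*) [RCLike 𝕜] {X : Type*} [NormedAddCommGroup X] [NormedSpace 𝕜 X]
    (f : X →L[𝕜] 𝕜) (x : X) : Prop :=
  ‖f‖ = 1 ∧ f x = (‖x‖ : 𝕜)

/-- `x` is a smooth point: it is nonzero and has exactly one supporting functional. -/
def IsSmoothPt (𝕜 : Type*) [RCLike 𝕜] {X : Type*} [NormedAddCommGroup X] [NormedSpace 𝕜 X]
    (x : X) : Prop :=
  x ≠ 0 ∧ ∃! f : X →L[𝕜] 𝕜, IsSuppFun 𝕜 f x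

section BirkhoffJames

variable {𝕜 X : Type*} [RCLike 𝕜] [NormedAddCommGroup X] [NormedSpace 𝕜 X]

theorem norm_eq_one_of_norm_le_of_apply_eq {f : X →L[𝕜] 𝕜} {x : X} (hx : x ≠ 0)
    (hf : ∀ y, ‖f y‖ ≤ ‖y‖) (hfx : f x = (‖x‖ : 𝕜)) : ‖f‖ = 1 := by
  apply le_antisymm
  · exact f.opNorm_le_bound zero_le_one (by simpa using hf)
  · have h := f.le_opNorm x
    rw [hfx, RCLike.norm_ofReal, abs_norm] at h
    exact le_of_mul_le_mul_right (by simpa using h) (norm_pos_iff.2 hx)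

theorem IsSuppFun.norm_apply_le {f : X →L[𝕜] 𝕜} {x : X} (hf : IsSuppFun 𝕜 f x) (y : X) :
    ‖f y‖ ≤ ‖y‖ := by
  simpa [hf.1] using f.le_opNorm y

theorem IsSuppFun.bjOrtho {f : X →L[𝕜] 𝕜} {x y : X} (hf : IsSuppFun 𝕜 f x) (hy : f y = 0) :
    BJOrtho 𝕜 x y := fun c ↦ by
  simpa [hy, hf.2] using hf.norm_apply_le (x + c • y)

theorem BJOrtho.exists_isSuppFun {x y : X} (hx : x ≠ 0) (h : BJOrtho 𝕜 x y) :
    ∃ f : X →L[𝕜] 𝕜, IsSuppFun 𝕜 f x ∧ f y = 0 := by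
  let S : Submodule 𝕜 X := Submodule.span 𝕜 {y}
  have hnorm : ‖(S.mkQ x)‖ = ‖x‖ := by
    apply le_antisymm (Submodule.Quotient.norm_mk_le S x)
    refine QuotientAddGroup.le_norm_iff.2 fun m hm ↦ ?_
    have hm' : m - x ∈ S := (Submodule.Quotient.eq S).1 hm
    obtain ⟨c, hc⟩ := Submodule.mem_span_singleton.1 hm'
    have := h c
    rwa [hc, add_sub_cancel] at this
  obtain ⟨g, hg, hgx⟩ := exists_dual_vector'' 𝕜 (S.mkQ x)
  have hle : ∀ z, ‖g (S.mkQ z)‖ ≤ ‖z‖ := fun z ↦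
    (g.le_of_opNorm_le hg _).trans (by simpa using Submodule.Quotient.norm_mk_le S z)
  let f : X →L[𝕜] 𝕜 := (g.toLinearMap.comp S.mkQ).mkContinuous 1 (by simpa using hle)
  have hfx : f x = (‖x‖ : 𝕜) := by rw [← hnorm]; exact hgx
  refine ⟨f, ⟨norm_eq_one_of_norm_le_of_apply_eq hx hle hfx, hfx⟩, ?_⟩
  have hy : S.mkQ y = 0 := by simp [S, Submodule.mem_span_singleton_self]
  change g (S.mkQ y) = 0
  rw [hy, map_zero]

theorem IsSmoothPt.bjOrtho_iff {f : X →L[𝕜] 𝕜} {x y : X} (hx : IsSmoothPt 𝕜 x)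
    (hf : IsSuppFun 𝕜 f x) : BJOrtho 𝕜 x y ↔ f y = 0 := by
  refine ⟨fun h ↦ ?_, hf.bjOrtho⟩
  obtain ⟨g, hg, hgy⟩ := h.exists_isSuppFun hx.1
  rwa [hx.2.unique hf hg]

theorem IsSuppFun.fderiv_norm [NormedSpace ℝ X] [IsScalarTower ℝ 𝕜 X] {f : X →L[𝕜] 𝕜} {x : X}
    (hf : IsSuppFun 𝕜 f x) (hx : DifferentiableAt ℝ (fun z : X ↦ ‖z‖) x) (y : X) :
    fderiv ℝ (fun z : X ↦ ‖z‖) x y = RCLike.re (f y) := by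
  let F : X →L[ℝ] ℝ := (RCLike.reCLM (K := 𝕜)).comp (f.restrictScalars ℝ)
  have hmin : IsLocalMin (fun z ↦ ‖z‖ - F z) x := by
    refine Filter.Eventually.of_forall fun z ↦ ?_
    have h1 : F x = ‖x‖ := by simp [F, hf.2]
    have h2 : F z ≤ ‖z‖ := (RCLike.re_le_norm _).trans (hf.norm_apply_le z)
    simp only [h1, sub_self]
    linarith
  have h := hmin.hasFDerivAt_eq_zero (hx.hasFDerivAt.sub F.hasFDerivAt)
  exact DFunLike.congr_fun (sub_eq_zero.1 h) y

theorem isSmoothPt_of_differentiableAt_norm [NormedSpace ℝ X] [IsScalarTower ℝ 𝕜 X] {x : X}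
    (hx0 : x ≠ 0) (hx : DifferentiableAt ℝ (fun z : X ↦ ‖z‖) x) : IsSmoothPt 𝕜 x := by
  obtain ⟨f, hf⟩ := exists_dual_vector 𝕜 x (norm_ne_zero_iff.2 hx0)
  refine ⟨hx0, f, hf, fun g hg ↦ ?_⟩
  have hre (y : X) : RCLike.re (g y) = RCLike.re (f y) := by
    rw [← hg.fderiv_norm hx, ← IsSuppFun.fderiv_norm hf hx]
  ext y
  refine RCLike.ext (hre y) ?_
  simpa using hre ((RCLike.I : 𝕜) • y)

theorem dense_setOf_eq_zero_or_isSmoothPt [FiniteDimensional 𝕜 X] :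
    Dense {x : X | x = 0 ∨ IsSmoothPt 𝕜 x} := by
  let : NormedSpace ℝ X := NormedSpace.restrictScalars ℝ 𝕜 X
  have : IsScalarTower ℝ 𝕜 X := IsScalarTower.of_algebraMap_smul fun _ _ ↦ rfl
  have : FiniteDimensional ℝ X := FiniteDimensional.trans ℝ 𝕜 X
  let : MeasurableSpace X := borel X
  have : BorelSpace X := ⟨rfl⟩
  have h := MeasureTheory.Measure.dense_of_ae
    (lipschitzWith_one_norm (E := X)).ae_differentiableAt (μ := MeasureTheory.Measure.addHaar)
  exact h.mono fun x hx ↦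
    or_iff_not_imp_left.2 fun h0 ↦ isSmoothPt_of_differentiableAt_norm h0 hx

theorem norm_le_of_bjOrtho_of_apply_eq_zero {f : X →L[𝕜] 𝕜} {x₀ x : X} (hx₀ : x₀ ≠ 0)
    (hf : IsSuppFun 𝕜 f x₀) (h : ∀ y, f y = 0 → BJOrtho 𝕜 x y) : ‖x‖ ≤ ‖f x‖ := by
  have hn : (‖x₀‖ : 𝕜) ≠ 0 := by simpa using hx₀
  have hk : f (x - (f x / ‖x₀‖) • x₀) = 0 := by
    simp [hf.2, div_mul_cancel₀ _ hn]
  have := h _ hk (-1)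
  simpa [norm_smul, div_mul_cancel₀ _ (norm_ne_zero_iff.2 hx₀)] using this

theorem apply_eq_zero_of_norm_le {f : X →L[𝕜] 𝕜} {x y : X} (hf : IsSuppFun 𝕜 f x)
    (h : ∀ c : 𝕜, ‖c • y‖ ≤ 1 → ‖x + c • y‖ ≤ ‖x‖) : f y = 0 := by
  let t : ℝ := (‖f y‖ * ‖y‖ + 1)⁻¹
  have ht : 0 < t := by positivity
  have hc := h ((t : 𝕜) * (starRingEnd 𝕜) (f y)) (by
    rw [norm_smul, norm_mul, RCLike.norm_ofReal, RCLike.norm_conj, abs_of_pos ht, mul_assoc]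
    exact (inv_mul_le_one₀ (by positivity)).2 (by linarith))
  have h1 := (hf.norm_apply_le _).trans hc
  have h2 : f (x + ((t : 𝕜) * (starRingEnd 𝕜) (f y)) • y) = ((‖x‖ + t * ‖f y‖ ^ 2 : ℝ) : 𝕜) := by
    rw [map_add, map_smul, hf.2, smul_eq_mul, mul_assoc, RCLike.conj_mul]
    push_cast
    rfl
  rw [h2, RCLike.norm_ofReal, abs_of_nonneg (by positivity)] at h1
  have h3 : t * ‖f y‖ ^ 2 = 0 := le_antisymm (by linarith) (by positivity)
  simpa [ht.ne'] using h3

section SupNorm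

variable {ι : Type*} [Fintype ι] {A : X ≃ₗ[𝕜] (ι → 𝕜)}

theorem norm_coord_le (hA : ∀ x, ‖x‖ = ‖A x‖) (i : ι) (y : X) : ‖A y i‖ ≤ ‖y‖ :=
  hA y ▸ norm_le_pi_norm (A y) i

/-- The `i`-th coordinate functional of a linear isometry onto `ι → 𝕜` with the sup norm. -/
noncomputable def coordFun (hA : ∀ x, ‖x‖ = ‖A x‖) (i : ι) : X →L[𝕜] 𝕜 :=
  ((LinearMap.proj i : (ι → 𝕜) →ₗ[𝕜] 𝕜).comp A.toLinearMap).mkContinuous 1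
    (by simpa using norm_coord_le hA i)

theorem coordFun_apply (hA : ∀ x, ‖x‖ = ‖A x‖) (i : ι) (y : X) : coordFun hA i y = A y i := rfl

theorem IsSmoothPt.exists_bjOrtho_iff_coord_eq_zero [Nonempty ι] (hA : ∀ x, ‖x‖ = ‖A x‖) {x : X}
    (hx : IsSmoothPt 𝕜 x) : ∃ i, ∀ y, BJOrtho 𝕜 x y ↔ A y i = 0 := by
  obtain ⟨i, hi⟩ := Finite.exists_max fun i ↦ ‖A x i‖
  have hxi : ‖A x i‖ = ‖x‖ := le_antisymm (norm_coord_le hA i x)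
    (hA x ▸ (pi_norm_le_iff_of_nonneg (norm_nonneg _)).2 hi)
  have hn : (‖x‖ : 𝕜) ≠ 0 := by simpa using hx.1
  let u : 𝕜 := (starRingEnd 𝕜) (A x i) / ‖x‖
  have hu : ‖u‖ = 1 := by
    simp [u, hxi, hx.1]
  have hu0 : u ≠ 0 := norm_ne_zero_iff.1 (by simp [hu])
  have hgx : (u • coordFun hA i) x = (‖x‖ : 𝕜) := by
    simp only [smul_apply, coordFun_apply, smul_eq_mul, u]
    rw [div_mul_eq_mul_div, RCLike.conj_mul, hxi, pow_two, mul_div_cancel_right₀ _ hn]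
  have hg : IsSuppFun 𝕜 (u • coordFun hA i) x :=
    ⟨norm_eq_one_of_norm_le_of_apply_eq hx.1
      (fun y ↦ by simpa [hu, coordFun_apply] using norm_coord_le hA i y) hgx, hgx⟩
  exact ⟨i, fun y ↦ by simp [hx.bjOrtho_iff hg, hu0, coordFun_apply]⟩

theorem exists_isSmoothPt_bjOrtho_iff_coord_eq_zero [DecidableEq ι] (hA : ∀ x, ‖x‖ = ‖A x‖)
    (i : ι) : ∃ x : X, IsSmoothPt 𝕜 x ∧ ∀ y, BJOrtho 𝕜 x y ↔ A y i = 0 := by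
  let x : X := A.symm (Pi.single i 1)
  have hAx : A x = Pi.single i 1 := A.apply_symm_apply _
  have hx1 : ‖x‖ = 1 := by rw [hA, hAx, Pi.norm_single, norm_one]
  have hx0 : x ≠ 0 := norm_ne_zero_iff.1 (by simp [hx1])
  have hfx : coordFun hA i x = (‖x‖ : 𝕜) := by simp [coordFun_apply, hAx, hx1]
  have hf : IsSuppFun 𝕜 (coordFun hA i) x :=
    ⟨norm_eq_one_of_norm_le_of_apply_eq hx0 (norm_coord_le hA i) hfx, hfx⟩
  have hx : IsSmoothPt 𝕜 x := by
    refine ⟨hx0, _, hf, fun g hg ↦ ?_⟩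
    have hker : ∀ y, A y i = 0 → g y = 0 := fun y hy ↦ by
      refine apply_eq_zero_of_norm_le hg fun c hc ↦ ?_
      rw [hx1, hA, pi_norm_le_iff_of_nonneg zero_le_one]
      intro j
      by_cases hj : j = i
      · subst hj
        simp [hAx, hy]
      · simpa [hAx, hj] using (norm_coord_le hA j (c • y)).trans hc
    ext y
    have h := hker (y - A y i • x) (by simp [hAx])
    rw [map_sub, map_smul, hg.2, hx1, sub_eq_zero] at h
    simpa [coordFun_apply] using h
  exact ⟨x, hx, fun y ↦ hx.bjOrtho_iff hf⟩

theorem ncard_setOf_bjOrtho_of_norm_eq [Nonempty ι] (hA : ∀ x, ‖x‖ = ‖A x‖) :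
    {S : Set X | ∃ x : X, IsSmoothPt 𝕜 x ∧ S = {y : X | BJOrtho 𝕜 x y}}.ncard
      = Fintype.card ι := by
  classical
  have hrange : {S : Set X | ∃ x : X, IsSmoothPt 𝕜 x ∧ S = {y : X | BJOrtho 𝕜 x y}}
      = Set.range fun i : ι ↦ {y : X | A y i = 0} := by
    ext S
    constructor
    · rintro ⟨x, hx, rfl⟩
      obtain ⟨i, hi⟩ := hx.exists_bjOrtho_iff_coord_eq_zero hA
      exact ⟨i, by ext y; exact (hi y).symm⟩
    · rintro ⟨i, rfl⟩
      obtain ⟨x, hx, hi⟩ := exists_isSmoothPt_bjOrtho_iff_coord_eq_zero hA i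
      exact ⟨x, hx, by ext y; exact (hi y).symm⟩
  have hinj : Function.Injective fun i : ι ↦ {y : X | A y i = 0} := by
    intro i j hij
    by_contra hne
    have h : A.symm (Pi.single i 1) ∈ {y : X | A y i = 0} := by
      simp only at hij
      rw [hij]
      simp [Ne.symm hne]
    simp at h
  rw [hrange, ← Set.image_univ, Set.ncard_image_of_injective _ hinj, Set.ncard_univ,
    Nat.card_eq_fintype_card]

end SupNorm

theorem exists_linearEquiv_norm_eq [FiniteDimensional 𝕜 X] (hn : 1 ≤ Module.finrank 𝕜 X)
    (h : {S : Set X | ∃ x : X, IsSmoothPt 𝕜 x ∧ S = {y : X | BJOrtho 𝕜 x y}}.ncard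
      = Module.finrank 𝕜 X) :
    ∃ A : X ≃ₗ[𝕜] (Fin (Module.finrank 𝕜 X) → 𝕜), ∀ x : X, ‖x‖ = ‖A x‖ := by
  set 𝒮 : Set (Set X) := {S | ∃ x : X, IsSmoothPt 𝕜 x ∧ S = {y : X | BJOrtho 𝕜 x y}}
  have : Finite 𝒮 := Set.finite_of_ncard_ne_zero (by omega)
  let e : 𝒮 ≃ Fin (Module.finrank 𝕜 X) := Finite.equivFinOfCardEq h
  choose x hx hxS using fun S : 𝒮 ↦ S.2
  choose f hf using fun S : 𝒮 ↦ (hx S).2.exists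
  let L : X →ₗ[𝕜] (Fin (Module.finrank 𝕜 X) → 𝕜) :=
    LinearMap.pi fun i ↦ (f (e.symm i)).toLinearMap
  have hle (z : X) : ‖L z‖ ≤ ‖z‖ :=
    (pi_norm_le_iff_of_nonneg (norm_nonneg _)).2 fun i ↦ (hf (e.symm i)).norm_apply_le z
  have hclosed : IsClosed {z : X | ‖z‖ ≤ ‖L z‖} :=
    isClosed_le continuous_norm L.continuous_of_finiteDimensional.norm
  have hge (z : X) : ‖z‖ ≤ ‖L z‖ := by
    refine hclosed.closure_subset_iff.2 ?_ (dense_setOf_eq_zero_or_isSmoothPt (𝕜 := 𝕜) z)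
    rintro w (rfl | hw)
    · simp
    · let S : 𝒮 := ⟨{y : X | BJOrtho 𝕜 w y}, w, hw, rfl⟩
      have hwS : ‖w‖ ≤ ‖f S w‖ := by
        refine norm_le_of_bjOrtho_of_apply_eq_zero (hx S).1 (hf S) fun y hy ↦ ?_
        have hy' : y ∈ (S : Set X) := by
          rw [hxS S]
          exact (hf S).bjOrtho hy
        exact hy'
      have hLS := norm_le_pi_norm (L w) (e S)
      refine hwS.trans ?_
      simpa [L] using hLS
  have hinj : Function.Injective L := (injective_iff_map_eq_zero L).2 fun z hz ↦ by
    simpa [hz] using hge z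
  exact ⟨L.linearEquivOfInjective hinj (by simp), fun z ↦ le_antisymm (hge z) (hle z)⟩

end BirkhoffJames

/-- A finite-dimensional normed space of dimension `n ≥ 1` is linearly isometric to
`(𝕜ⁿ, ‖·‖_∞)` (note: the norm on `Fin n → 𝕜` is the supremum norm) if and only if the family
of outgoing neighborhoods `x^⊥` of smooth points `x` has exactly `n` elements. -/
theorem stmt3 {𝕜 X : Type*} [RCLike 𝕜] [NormedAddCommGroup X] [NormedSpace 𝕜 X]
    [FiniteDimensional 𝕜 X] (hn : 1 ≤ Module.finrank 𝕜 X) :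
    (∃ A : X ≃ₗ[𝕜] (Fin (Module.finrank 𝕜 X) → 𝕜), ∀ x : X, ‖x‖ = ‖A x‖) ↔
    {S : Set X | ∃ x : X, IsSmoothPt 𝕜 x ∧ S = {y : X | BJOrtho 𝕜 x y}}.ncard
      = Module.finrank 𝕜 X := by
  have : Nonempty (Fin (Module.finrank 𝕜 X)) := ⟨⟨0, hn⟩⟩
  refine ⟨?_, exists_linearEquiv_norm_eq hn⟩
  rintro ⟨A, hA⟩
  simpa using ncard_setOf_bjOrtho_of_norm_eq hA
end

section
/- Let X be a complex normed space and F ⊆ X. Then there exists a continuous ℝ-linear functional f : X → ℝ with F = {x ∈ X : ‖x‖ = 1 and f(x) = ‖f‖} if and only if there exists a continuous ℂ-linear functional g : X → ℂ with F = {x ∈ X : ‖x‖ = 1 and g(x) = ‖g‖}. -/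
/-- At a unit vector, a continuous real functional attains its norm if and only if its complex
extension does. -/
theorem StrongDual.extendRCLike_apply_eq_norm_iff {X : Type*} [NormedAddCommGroup X]
    [NormedSpace ℂ X] (f : StrongDual ℝ X) {x : X} (hx : ‖x‖ = 1) :
    f.extendRCLike (𝕜 := ℂ) x = (‖f.extendRCLike (𝕜 := ℂ)‖ : ℂ) ↔ f x = ‖f‖ := by
  have hnorm : ‖f.extendRCLike (𝕜 := ℂ)‖ = ‖f‖ :=
    (StrongDual.extendRCLikeₗᵢ (𝕜 := ℂ) (F := X)).norm_map f
  have hre : (f.extendRCLike (𝕜 := ℂ) x).re = f x := f.re_extendRCLike_apply (𝕜 := ℂ) x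
  have hle : ‖f.extendRCLike (𝕜 := ℂ) x‖ ≤ ‖f‖ := by
    simpa [hx, hnorm] using (f.extendRCLike (𝕜 := ℂ)).le_opNorm x
  rw [hnorm]
  refine ⟨fun h ↦ by rw [← hre, h, Complex.ofReal_re], fun h ↦ ?_⟩
  have heq : (f.extendRCLike (𝕜 := ℂ) x).re = ‖f.extendRCLike (𝕜 := ℂ) x‖ :=
    le_antisymm (Complex.re_le_norm _) (by rwa [hre, h])
  have him := (Complex.nonneg_iff.mp (Complex.re_eq_norm.mp heq)).2
  exact Complex.ext (by rw [hre, h, Complex.ofReal_re]) (by rw [← him, Complex.ofReal_im])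

/-- A subset `F` of a complex normed space is an exposed face for some continuous ℝ-linear
functional if and only if it is an exposed face for some continuous ℂ-linear functional. -/
theorem stmt4 {X : Type*} [NormedAddCommGroup X] [NormedSpace ℂ X] (F : Set X) :
    (∃ f : X →L[ℝ] ℝ, F = {x : X | ‖x‖ = 1 ∧ f x = ‖f‖}) ↔
    (∃ g : X →L[ℂ] ℂ, F = {x : X | ‖x‖ = 1 ∧ g x = (‖g‖ : ℂ)}) := by
  refine Iff.trans (exists_congr fun f ↦ ?_)
    (StrongDual.extendRCLikeₗ (𝕜 := ℂ) (F := X)).surjective.exists.symm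
  have hset : {x : X | ‖x‖ = 1 ∧ StrongDual.extendRCLikeₗ (𝕜 := ℂ) f x =
      (‖StrongDual.extendRCLikeₗ (𝕜 := ℂ) f‖ : ℂ)} = {x : X | ‖x‖ = 1 ∧ f x = ‖f‖} :=
    Set.ext fun x ↦ and_congr_right fun hx ↦ StrongDual.extendRCLike_apply_eq_norm_iff f hx
  rw [hset]
end

section
/- Let X be a finite-dimensional normed space over 𝔽 ∈ {ℝ, ℂ} and let f be a continuous linear functional on X with ‖f‖ = 1. Then f is a supporting functional of some smooth point of X if and only if f is an exposed point of the dual space X*, i.e., there exists a continuous linear functional φ on X* such that {f} = { g ∈ X* : ‖g‖ = 1 and φ(g) = ‖φ‖ }. -/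
/-- A finite-dimensional normed space is reflexive. -/
theorem NormedSpace.inclusionInDoubleDualLi_surjective (𝕜 X : Type*) [RCLike 𝕜]
    [NormedAddCommGroup X] [NormedSpace 𝕜 X] [FiniteDimensional 𝕜 X] :
    Function.Surjective (NormedSpace.inclusionInDoubleDualLi 𝕜 (E := X)) := by
  intro φ
  refine ⟨(Module.evalEquiv 𝕜 X).symm
    (φ.toLinearMap ∘ₗ (LinearMap.toContinuousLinearMap (𝕜 := 𝕜) (E := X)
      (F' := 𝕜)).toLinearMap), ?_⟩
  ext g
  exact Module.apply_evalEquiv_symm_apply 𝕜 X g.toLinearMap _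

/-- In a finite-dimensional normed space, a norm-one functional `f` is a supporting functional
of some smooth point if and only if `f` is an exposed point of the dual unit ball. -/
theorem stmt5 {𝕜 X : Type*} [RCLike 𝕜] [NormedAddCommGroup X] [NormedSpace 𝕜 X]
    [FiniteDimensional 𝕜 X] (f : X →L[𝕜] 𝕜) (hf : ‖f‖ = 1) :
    (∃ x : X, IsSmoothPt 𝕜 x ∧ IsSuppFun 𝕜 f x) ↔
    (∃ φ : (X →L[𝕜] 𝕜) →L[𝕜] 𝕜,
      ({f} : Set (X →L[𝕜] 𝕜)) = {g : X →L[𝕜] 𝕜 | ‖g‖ = 1 ∧ φ g = (‖φ‖ : 𝕜)}) := by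
  constructor
  · rintro ⟨x, ⟨-, hx⟩, hfx⟩
    refine ⟨NormedSpace.inclusionInDoubleDualLi 𝕜 x, ?_⟩
    rw [LinearIsometry.norm_map]
    ext g
    exact ⟨fun h => h ▸ hfx, fun h => hx.unique h hfx⟩
  · rintro ⟨φ, hφ⟩
    obtain ⟨x, rfl⟩ := NormedSpace.inclusionInDoubleDualLi_surjective 𝕜 X φ
    rw [LinearIsometry.norm_map] at hφ
    have hiff (g : X →L[𝕜] 𝕜) : g = f ↔ IsSuppFun 𝕜 g x := Set.ext_iff.mp hφ g
    have hfx := (hiff f).mp rfl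
    refine ⟨x, ⟨?_, f, hfx, fun g hg => (hiff g).mpr hg⟩, hfx⟩
    rintro rfl
    have hneg : -f = f := (hiff _).mpr ⟨by rw [norm_neg, hf], by simp⟩
    have hzero : f = 0 := by
      ext y
      exact neg_eq_self.mp (DFunLike.congr_fun hneg y)
    simp [hzero] at hf
end

section
/- Let X be a normed space over 𝔽 ∈ {ℝ, ℂ} of finite dimension n ≥ 1. Then there exist smooth points x₁, …, xₙ of X whose (unique) supporting functionals f₁, …, fₙ are linearly independent in the dual space X*. -/
/-- At a point where the norm is real-differentiable, supporting functionals are unique. -/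
theorem IsSuppFun.eq_of_differentiableAt_norm {𝕜 X : Type*} [RCLike 𝕜] [NormedAddCommGroup X]
    [NormedSpace 𝕜 X] [NormedSpace ℝ X] [IsScalarTower ℝ 𝕜 X] {x : X}
    (hx : DifferentiableAt ℝ (fun y : X => ‖y‖) x) {f g : X →L[𝕜] 𝕜}
    (hf : IsSuppFun 𝕜 f x) (hg : IsSuppFun 𝕜 g x) : f = g := by
  have key : ∀ h : X →L[𝕜] 𝕜, IsSuppFun 𝕜 h x →
      fderiv ℝ (fun y : X => ‖y‖) x = RCLike.reCLM.comp (h.restrictScalars ℝ) := by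
    intro h hh
    have hmin : IsLocalMin
        (fun y : X => ‖y‖ - RCLike.reCLM.comp (h.restrictScalars ℝ) y) x := by
      refine Filter.Eventually.of_forall fun y => ?_
      have h1 : RCLike.re (h y) ≤ ‖y‖ := by
        have := h.le_opNorm y
        rw [hh.1, one_mul] at this
        exact (RCLike.re_le_norm _).trans this
      simp only [ContinuousLinearMap.comp_apply, ContinuousLinearMap.coe_restrictScalars',
        RCLike.reCLM_apply, hh.2, RCLike.ofReal_re]
      linarith
    exact sub_eq_zero.1 (hmin.hasFDerivAt_eq_zero
      (hx.hasFDerivAt.sub (RCLike.reCLM.comp (h.restrictScalars ℝ)).hasFDerivAt))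
  have hre : ∀ y, RCLike.re (f y) = RCLike.re (g y) := fun y => by
    simpa using DFunLike.congr_fun ((key f hf).symm.trans (key g hg)) y
  ext y
  refine RCLike.ext (hre y) ?_
  have := hre ((RCLike.I : 𝕜) • y)
  simpa using this

/-- Smooth points are dense in a finite-dimensional space: every nonzero vector is within any
positive distance of a smooth point. -/
theorem exists_isSmoothPt_norm_sub_lt {𝕜 X : Type*} [RCLike 𝕜] [NormedAddCommGroup X]
    [NormedSpace 𝕜 X] [FiniteDimensional 𝕜 X] {v : X} (hv : v ≠ 0) {ε : ℝ} (hε : 0 < ε) :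
    ∃ x : X, IsSmoothPt 𝕜 x ∧ ‖x - v‖ < ε := by
  let _ : NormedSpace ℝ X := NormedSpace.restrictScalars ℝ 𝕜 X
  have : IsScalarTower ℝ 𝕜 X := RestrictScalars.isScalarTower ℝ 𝕜 X
  have : FiniteDimensional ℝ X := FiniteDimensional.trans ℝ 𝕜 X
  obtain ⟨x, hxv, hx⟩ := Metric.dense_iff.1 (dense_differentiableAt_norm (E := X)) v
    (min ε ‖v‖) (lt_min hε (norm_pos_iff.2 hv))
  rw [Metric.mem_ball, dist_eq_norm, lt_min_iff] at hxv
  have hx0 : x ≠ 0 := by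
    rintro rfl
    simp at hxv
  obtain ⟨f, hf⟩ := exists_dual_vector 𝕜 x (norm_ne_zero_iff.2 hx0)
  exact ⟨x, ⟨hx0, f, hf, fun g hg => IsSuppFun.eq_of_differentiableAt_norm hx hg hf⟩, hxv.1⟩

/-- A set of functionals with no common nonzero zero spans the dual of a finite-dimensional
space. -/
theorem span_eq_top_of_forall_exists_apply_ne_zero {𝕜 X : Type*} [RCLike 𝕜]
    [NormedAddCommGroup X] [NormedSpace 𝕜 X] [FiniteDimensional 𝕜 X] {S : Set (X →L[𝕜] 𝕜)}
    (hS : ∀ v : X, v ≠ 0 → ∃ f ∈ S, f v ≠ 0) : Submodule.span 𝕜 S = ⊤ := by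
  by_contra hne
  obtain ⟨φ, hφ, hker⟩ := Submodule.exists_le_ker_of_lt_top _ (lt_top_iff_ne_top.2 hne)
  let e : (X →ₗ[𝕜] 𝕜) ≃ₗ[𝕜] (X →L[𝕜] 𝕜) := LinearMap.toContinuousLinearMap
  obtain ⟨v, hv⟩ := (Module.evalEquiv 𝕜 X).surjective (φ.comp e.toLinearMap)
  have happ : ∀ f : X →L[𝕜] 𝕜, φ f = f v := fun f => by
    have := DFunLike.congr_fun hv (e.symm f)
    simp only [LinearMap.comp_apply, LinearEquiv.coe_coe, LinearEquiv.apply_symm_apply] at this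
    rw [← this]
    rfl
  have hv0 : v ≠ 0 := by
    rintro rfl
    exact hφ (LinearMap.ext fun f => by simp [happ])
  obtain ⟨f, hf, hfv⟩ := hS v hv0
  exact hfv ((happ f).symm.trans (hker (Submodule.subset_span hf)))

/-- The supporting functionals of smooth points span the dual of a finite-dimensional space. -/
theorem span_isSuppFun_isSmoothPt_eq_top (𝕜 X : Type*) [RCLike 𝕜] [NormedAddCommGroup X]
    [NormedSpace 𝕜 X] [FiniteDimensional 𝕜 X] :
    Submodule.span 𝕜 {f : X →L[𝕜] 𝕜 | ∃ x, IsSmoothPt 𝕜 x ∧ IsSuppFun 𝕜 f x} = ⊤ := by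
  refine span_eq_top_of_forall_exists_apply_ne_zero fun v hv => ?_
  obtain ⟨x, hx, hxv⟩ :=
    exists_isSmoothPt_norm_sub_lt (𝕜 := 𝕜) hv (half_pos (norm_pos_iff.2 hv))
  obtain ⟨f, hf, -⟩ := hx.2
  refine ⟨f, ⟨x, hx, hf⟩, fun hfv => ?_⟩
  have h1 := f.le_opNorm (x - v)
  rw [map_sub, hfv, sub_zero, hf.1, hf.2, one_mul, RCLike.norm_ofReal, abs_norm] at h1
  have h2 := norm_sub_norm_le v x
  rw [norm_sub_rev] at h2
  linarith

/-- A finite-dimensional normed space of dimension `n ≥ 1` has `n` smooth points whose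
supporting functionals are linearly independent in the dual space. -/
theorem stmt6 {𝕜 X : Type*} [RCLike 𝕜] [NormedAddCommGroup X] [NormedSpace 𝕜 X]
    [FiniteDimensional 𝕜 X] (hn : 1 ≤ Module.finrank 𝕜 X) :
    ∃ (x : Fin (Module.finrank 𝕜 X) → X) (f : Fin (Module.finrank 𝕜 X) → (X →L[𝕜] 𝕜)),
      (∀ i, IsSmoothPt 𝕜 (x i)) ∧ (∀ i, IsSuppFun 𝕜 (f i) (x i)) ∧
      LinearIndependent 𝕜 f := by
  have hspan := span_isSuppFun_isSmoothPt_eq_top 𝕜 X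
  obtain ⟨b, hbS, hb, hli⟩ := exists_linearIndependent 𝕜
    {f : X →L[𝕜] 𝕜 | ∃ x, IsSmoothPt 𝕜 x ∧ IsSuppFun 𝕜 f x}
  let e : (X →ₗ[𝕜] 𝕜) ≃ₗ[𝕜] (X →L[𝕜] 𝕜) := LinearMap.toContinuousLinearMap
  have : FiniteDimensional 𝕜 (X →L[𝕜] 𝕜) := e.finiteDimensional
  have hfin : Module.finrank 𝕜 (X →L[𝕜] 𝕜) = Module.finrank 𝕜 X :=
    e.finrank_eq.symm.trans Subspace.dual_finrank_eq
  let B : Module.Basis b 𝕜 (X →L[𝕜] 𝕜) :=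
    Module.Basis.mk hli (by rw [Subtype.range_coe, hb, hspan])
  have : Fintype b := FiniteDimensional.fintypeBasisIndex B
  let σ : Fin (Module.finrank 𝕜 X) ≃ b := (Fintype.equivFinOfCardEq
    ((Module.finrank_eq_card_basis B).symm.trans hfin)).symm
  choose x hx using fun i => hbS (σ i).2
  exact ⟨x, fun i => σ i, fun i => (hx i).1, fun i => (hx i).2, hli.comp σ σ.injective⟩
end

section
/- Let X be a two-dimensional normed space over 𝔽 ∈ {ℝ, ℂ} and let x ∈ X be nonzero. Then x is a smooth point if and only if x^⊥ consists of exactly one line, i.e., there exists a nonzero vector v with x^⊥ = 𝔽v. -/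
theorem bjOrtho_of_isSuppFun {𝕜 X : Type*} [RCLike 𝕜] [NormedAddCommGroup X] [NormedSpace 𝕜 X]
    {x y : X} {f : X →L[𝕜] 𝕜} (hf : IsSuppFun 𝕜 f x) (hy : f y = 0) : BJOrtho 𝕜 x y := by
  intro c
  have h := f.le_opNorm (x + c • y)
  simpa [hf.1, hf.2, hy] using h

/-- James' characterization of Birkhoff–James orthogonality by supporting functionals. -/
theorem bjOrtho_iff_exists_isSuppFun {𝕜 X : Type*} [RCLike 𝕜] [NormedAddCommGroup X]
    [NormedSpace 𝕜 X] {x : X} (hx : x ≠ 0) (y : X) :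
    BJOrtho 𝕜 x y ↔ ∃ f : X →L[𝕜] 𝕜, IsSuppFun 𝕜 f x ∧ f y = 0 := by
  refine ⟨fun h => ?_, fun ⟨f, hf, hy⟩ => bjOrtho_of_isSuppFun hf hy⟩
  let S : Submodule 𝕜 X := 𝕜 ∙ y
  have hnorm : ‖S.mkQ x‖ = ‖x‖ := by
    refine le_antisymm (Submodule.Quotient.norm_mk_le S x) ?_
    refine le_of_forall_pos_le_add fun ε hε => ?_
    obtain ⟨m, hm, hlt⟩ := Submodule.Quotient.norm_mk_lt (S := S) (S.mkQ x) hε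
    have hmem : m - x ∈ S := (Submodule.Quotient.eq S).1 hm
    obtain ⟨c, hc⟩ := Submodule.mem_span_singleton.1 hmem
    have hmx : x + c • y = m := by rw [hc]; abel
    exact ((h c).trans_eq (congrArg norm hmx)).trans hlt.le
  obtain ⟨g, hg, hgx⟩ := exists_dual_vector 𝕜 (S.mkQ x) (by rw [hnorm]; exact norm_ne_zero_iff.2 hx)
  have hle : ∀ z, ‖g (S.mkQ z)‖ ≤ 1 * ‖z‖ := fun z => by
    have h1 := g.le_opNorm (S.mkQ z)
    rw [hg] at h1
    exact h1.trans (by gcongr; exact Submodule.Quotient.norm_mk_le S z)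
  let f : X →L[𝕜] 𝕜 := (g.toLinearMap ∘ₗ S.mkQ).mkContinuous 1 hle
  have hfx : f x = (‖x‖ : 𝕜) := by rw [← hnorm]; exact hgx
  have hfy : f y = 0 := by
    have h0 : S.mkQ y = 0 :=
      (Submodule.Quotient.mk_eq_zero S).2 (Submodule.mem_span_singleton_self y)
    change g (S.mkQ y) = 0
    rw [h0, map_zero]
  refine ⟨f, ⟨le_antisymm (LinearMap.mkContinuous_norm_le _ zero_le_one _) ?_, hfx⟩, hfy⟩
  have h1 := f.le_opNorm x
  rw [hfx, RCLike.norm_ofReal, abs_norm] at h1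
  exact le_of_mul_le_mul_right (by rwa [one_mul]) (norm_pos_iff.2 hx)

theorem LinearMap.exists_ker_eq_line {𝕜 X : Type*} [Field 𝕜] [AddCommGroup X] [Module 𝕜 X]
    (h2 : Module.finrank 𝕜 X = 2) {f : X →ₗ[𝕜] 𝕜} (hf : f ≠ 0) :
    ∃ v : X, v ≠ 0 ∧ ∀ y, f y = 0 ↔ ∃ c : 𝕜, y = c • v := by
  have : FiniteDimensional 𝕜 X := Module.finite_of_finrank_pos (by omega)
  have h := Module.Dual.finrank_ker_add_one_of_ne_zero hf
  obtain ⟨v, hv, hspan⟩ := finrank_eq_one_iff'.1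
    (show Module.finrank 𝕜 (LinearMap.ker f) = 1 by omega)
  refine ⟨v, fun h0 => hv (Subtype.ext h0), fun y => ⟨fun hy => ?_, ?_⟩⟩
  · obtain ⟨c, hc⟩ := hspan ⟨y, hy⟩
    exact ⟨c, (congrArg Subtype.val hc).symm⟩
  · rintro ⟨c, rfl⟩
    rw [map_smul, LinearMap.mem_ker.1 v.2, smul_zero]

theorem IsSuppFun.exists_ker_eq_line {𝕜 X : Type*} [RCLike 𝕜] [NormedAddCommGroup X]
    [NormedSpace 𝕜 X] (h2 : Module.finrank 𝕜 X = 2) {x : X} {f : X →L[𝕜] 𝕜}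
    (hf : IsSuppFun 𝕜 f x) : ∃ v : X, v ≠ 0 ∧ ∀ y, f y = 0 ↔ ∃ c : 𝕜, y = c • v := by
  refine LinearMap.exists_ker_eq_line h2 (f := f.toLinearMap) fun h0 => ?_
  have : f = 0 := ContinuousLinearMap.coe_injective h0
  simpa [this] using hf.1

/-- In a two-dimensional normed space, a nonzero `x` is smooth iff `x^⊥` is a single line. -/
theorem stmt8 {𝕜 X : Type*} [RCLike 𝕜] [NormedAddCommGroup X] [NormedSpace 𝕜 X]
    (h2 : Module.finrank 𝕜 X = 2) (x : X) (hx : x ≠ 0) :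
    IsSmoothPt 𝕜 x ↔
      ∃ v : X, v ≠ 0 ∧ {y : X | BJOrtho 𝕜 x y} = {y : X | ∃ c : 𝕜, y = c • v} := by
  constructor
  · rintro ⟨-, f, hf, huniq⟩
    obtain ⟨v, hv, hker⟩ := hf.exists_ker_eq_line h2
    refine ⟨v, hv, Set.ext fun y => ?_⟩
    rw [Set.mem_ofPred_eq, Set.mem_ofPred_eq, ← hker, bjOrtho_iff_exists_isSuppFun hx]
    exact ⟨fun ⟨g, hg, hgy⟩ => huniq g hg ▸ hgy, fun hy => ⟨f, hf, hy⟩⟩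
  · rintro ⟨v, -, hline⟩
    have hmem : ∀ y, BJOrtho 𝕜 x y → ∃ c : 𝕜, y = c • v := fun y hy => hline.subset hy
    obtain ⟨f, hf⟩ : ∃ f : X →L[𝕜] 𝕜, IsSuppFun 𝕜 f x :=
      exists_dual_vector 𝕜 x (norm_ne_zero_iff.2 hx)
    refine ⟨hx, f, hf, fun g hg => ?_⟩
    have hgv : g v = 0 := by
      obtain ⟨w, hw, hker⟩ := hg.exists_ker_eq_line h2
      have hgw : g w = 0 := (hker w).2 ⟨1, (one_smul 𝕜 w).symm⟩
      obtain ⟨c, rfl⟩ := hmem w (bjOrtho_of_isSuppFun hg hgw)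
      rw [map_smul, smul_eq_zero] at hgw
      exact hgw.resolve_left fun hc => hw (by rw [hc, zero_smul])
    have hx' : (‖x‖ : 𝕜) ≠ 0 := by simpa using hx
    ext y
    have hfy : f (y - (f y / (‖x‖ : 𝕜)) • x) = 0 := by
      rw [map_sub, map_smul, hf.2, smul_eq_mul, div_mul_cancel₀ _ hx', sub_self]
    obtain ⟨c, hc⟩ := hmem _ (bjOrtho_of_isSuppFun hf hfy)
    have hgy := congrArg g hc
    rw [map_sub, map_smul, map_smul, hg.2, hgv, smul_eq_mul, div_mul_cancel₀ _ hx',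
      smul_zero, sub_eq_zero] at hgy
    exact hgy
end

section
/- Let X and Y be normed spaces over 𝔽 ∈ {ℝ, ℂ} whose norms are BJ-norms. If there exists a bijection Φ : X → Y such that u ⊥ v if and only if Φ(u) ⊥ Φ(v) for all u, v ∈ X, then there exists a bijection Ψ : ℙX → ℙY such that [x] ⊥ [x'] if and only if Ψ([x]) ⊥ Ψ([x']) for all [x], [x'] ∈ ℙX. -/
/-- The norm is a BJ-norm: any two elements with the same outgoing and incoming
BJ-orthogonality neighborhoods are linearly dependent. -/
def IsBJNorm (𝕜 : Type*) [RCLike 𝕜] (X : Type*) [NormedAddCommGroup X] [NormedSpace 𝕜 X] :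
    Prop :=
  ∀ x y : X, {w : X | BJOrtho 𝕜 x w} = {w : X | BJOrtho 𝕜 y w} →
    {w : X | BJOrtho 𝕜 w x} = {w : X | BJOrtho 𝕜 w y} →
    ¬ LinearIndependent 𝕜 ![x, y]

/-- Birkhoff–James orthogonality on the projective space, via representatives
(well defined since BJ-orthogonality is homogeneous). -/
def BJP (𝕜 : Type*) [RCLike 𝕜] {X : Type*} [NormedAddCommGroup X] [NormedSpace 𝕜 X]
    (p q : Projectivization 𝕜 X) : Prop :=
  BJOrtho 𝕜 p.rep q.rep

namespace BJOrtho

variable {𝕜 X Y : Type*} [RCLike 𝕜] [NormedAddCommGroup X] [NormedSpace 𝕜 X]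
  [NormedAddCommGroup Y] [NormedSpace 𝕜 Y]

theorem self_iff {x : X} : BJOrtho 𝕜 x x ↔ x = 0 := by
  refine ⟨fun h => ?_, fun h c => by simp [h]⟩
  simpa using h (-1)

theorem smul_right {x y : X} (h : BJOrtho 𝕜 x y) (a : 𝕜) : BJOrtho 𝕜 x (a • y) := fun c => by
  simpa [smul_smul] using h (c * a)

theorem smul_left {x y : X} (h : BJOrtho 𝕜 x y) (a : 𝕜) : BJOrtho 𝕜 (a • x) y := fun c => by
  rcases eq_or_ne a 0 with rfl | ha
  · simp
  · have key : a • x + c • y = a • (x + (a⁻¹ * c) • y) := by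
      rw [smul_add, smul_smul, mul_inv_cancel_left₀ ha]
    rw [key, norm_smul, norm_smul]
    exact mul_le_mul_of_nonneg_left (h _) (norm_nonneg a)

theorem smul_left_iff (a : 𝕜ˣ) {x y : X} : BJOrtho 𝕜 (a • x) y ↔ BJOrtho 𝕜 x y :=
  ⟨fun h => by simpa [Units.smul_def, smul_smul] using h.smul_left (↑a⁻¹ : 𝕜),
    fun h => h.smul_left (a : 𝕜)⟩

theorem smul_right_iff (a : 𝕜ˣ) {x y : X} : BJOrtho 𝕜 x (a • y) ↔ BJOrtho 𝕜 x y :=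
  ⟨fun h => by simpa [Units.smul_def, smul_smul] using h.smul_right (↑a⁻¹ : 𝕜),
    fun h => h.smul_right (a : 𝕜)⟩

theorem rep_mk_iff {x y : X} (hx : x ≠ 0) (hy : y ≠ 0) :
    BJP 𝕜 (Projectivization.mk 𝕜 x hx) (Projectivization.mk 𝕜 y hy) ↔ BJOrtho 𝕜 x y := by
  obtain ⟨a, ha⟩ := Projectivization.exists_smul_eq_mk_rep 𝕜 x hx
  obtain ⟨b, hb⟩ := Projectivization.exists_smul_eq_mk_rep 𝕜 y hy
  rw [BJP, ← ha, ← hb, smul_left_iff, smul_right_iff]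

theorem mk_eq_mk_iff (hX : IsBJNorm 𝕜 X) {x y : X} (hx : x ≠ 0) (hy : y ≠ 0) :
    Projectivization.mk 𝕜 x hx = Projectivization.mk 𝕜 y hy ↔
      ∀ w, (BJOrtho 𝕜 x w ↔ BJOrtho 𝕜 y w) ∧ (BJOrtho 𝕜 w x ↔ BJOrtho 𝕜 w y) := by
  constructor
  · intro h w
    obtain ⟨a, rfl⟩ := (Projectivization.mk_eq_mk_iff 𝕜 x y hx hy).1 h
    exact ⟨smul_left_iff a, smul_right_iff a⟩
  · intro h
    have hdep := hX x y (Set.ext fun w => (h w).1) (Set.ext fun w => (h w).2)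
    rw [LinearIndependent.pair_iff' hx] at hdep
    push Not at hdep
    obtain ⟨a, ha⟩ := hdep
    exact ((Projectivization.mk_eq_mk_iff' 𝕜 y x hy hx).2 ⟨a, ha⟩).symm

theorem map_ne_zero_iff {Φ : X → Y} (hpres : ∀ u v, BJOrtho 𝕜 u v ↔ BJOrtho 𝕜 (Φ u) (Φ v))
    {x : X} : Φ x ≠ 0 ↔ x ≠ 0 := by
  rw [Ne, Ne, ← self_iff (𝕜 := 𝕜), ← self_iff (𝕜 := 𝕜), hpres]

theorem mk_map_eq_mk_map_iff (hX : IsBJNorm 𝕜 X) (hY : IsBJNorm 𝕜 Y) {Φ : X → Y}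
    (hΦ : Function.Surjective Φ) (hpres : ∀ u v, BJOrtho 𝕜 u v ↔ BJOrtho 𝕜 (Φ u) (Φ v))
    {x y : X} (hx : x ≠ 0) (hy : y ≠ 0) (hx' : Φ x ≠ 0) (hy' : Φ y ≠ 0) :
    Projectivization.mk 𝕜 (Φ x) hx' = Projectivization.mk 𝕜 (Φ y) hy' ↔
      Projectivization.mk 𝕜 x hx = Projectivization.mk 𝕜 y hy := by
  rw [mk_eq_mk_iff hX, mk_eq_mk_iff hY, hΦ.forall]
  simp only [← hpres]

end BJOrtho

/-- For BJ-normed spaces `X, Y`, a bijection `X → Y` preserving BJ-orthogonality in both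
directions induces a bijection `ℙX → ℙY` preserving BJ-orthogonality in both directions. -/
theorem stmt13 {𝕜 X Y : Type*} [RCLike 𝕜] [NormedAddCommGroup X] [NormedSpace 𝕜 X]
    [NormedAddCommGroup Y] [NormedSpace 𝕜 Y]
    (hX : IsBJNorm 𝕜 X) (hY : IsBJNorm 𝕜 Y)
    (Φ : X → Y) (hΦ : Function.Bijective Φ)
    (hpres : ∀ u v : X, BJOrtho 𝕜 u v ↔ BJOrtho 𝕜 (Φ u) (Φ v)) :
    ∃ Ψ : Projectivization 𝕜 X → Projectivization 𝕜 Y, Function.Bijective Ψ ∧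
      ∀ p q : Projectivization 𝕜 X, BJP 𝕜 p q ↔ BJP 𝕜 (Ψ p) (Ψ q) := by
  have hne (p : Projectivization 𝕜 X) : Φ p.rep ≠ 0 :=
    (BJOrtho.map_ne_zero_iff hpres).2 p.rep_nonzero
  refine ⟨fun p => Projectivization.mk 𝕜 (Φ p.rep) (hne p), ⟨fun p q h => ?_, fun q => ?_⟩,
    fun p q => ?_⟩
  · simpa using (BJOrtho.mk_map_eq_mk_map_iff hX hY hΦ.2 hpres p.rep_nonzero q.rep_nonzero
      (hne p) (hne q)).1 h
  · obtain ⟨x, hx⟩ := hΦ.2 q.rep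
    have hx' : Φ x ≠ 0 := hx ▸ q.rep_nonzero
    have hx0 : x ≠ 0 := (BJOrtho.map_ne_zero_iff hpres).1 hx'
    refine ⟨Projectivization.mk 𝕜 x hx0, ?_⟩
    have h := (BJOrtho.mk_map_eq_mk_map_iff hX hY hΦ.2 hpres
      (Projectivization.rep_nonzero _) hx0 (hne (Projectivization.mk 𝕜 x hx0)) hx').2
      (Projectivization.mk_rep _)
    simpa [hx] using h
  · rw [BJOrtho.rep_mk_iff, ← hpres, BJP]
end

section
/- Let a < b be real numbers, let f : [a,b] → ℝ be a nonconstant continuous function, and let g : [a,b] → ℝ be a function whose image is at most countable. Then the image of f + g has cardinality at least the continuum (i.e., it contains continuum many points). -/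
/-- A nonconstant continuous function on a closed interval takes continuum many values. -/
theorem continuum_le_mk_image_Icc_of_continuousOn {a b : ℝ} {f : ℝ → ℝ}
    (hf : ContinuousOn f (Set.Icc a b))
    (hfc : ∃ s ∈ Set.Icc a b, ∃ t ∈ Set.Icc a b, f s ≠ f t) :
    Cardinal.continuum ≤ Cardinal.mk (f '' Set.Icc a b) := by
  obtain ⟨s, hs, t, ht, hst⟩ := hfc
  have hconn : (f '' Set.Icc a b).OrdConnected :=
    (isPreconnected_Icc.image f hf).ordConnected
  have hsub : Set.uIcc (f s) (f t) ⊆ f '' Set.Icc a b :=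
    hconn.uIcc_subset (Set.mem_image_of_mem f hs) (Set.mem_image_of_mem f ht)
  calc Cardinal.continuum = Cardinal.mk (Set.uIcc (f s) (f t)) :=
        (Cardinal.mk_Icc_real (inf_lt_sup.2 hst)).symm
    _ ≤ Cardinal.mk (f '' Set.Icc a b) := Cardinal.mk_le_mk_of_subset hsub

/-- If `f : [a,b] → ℝ` is a nonconstant continuous function and `g : [a,b] → ℝ` has at most
countable image, then the image of `f + g` contains continuum many points. -/
theorem stmt14 (a b : ℝ) (hab : a < b) (f g : ℝ → ℝ)
    (hf : ContinuousOn f (Set.Icc a b))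
    (hfc : ∃ s ∈ Set.Icc a b, ∃ t ∈ Set.Icc a b, f s ≠ f t)
    (hg : (g '' Set.Icc a b).Countable) :
    Cardinal.continuum ≤ Cardinal.mk ((fun t => f t + g t) '' Set.Icc a b) := by
  by_contra! hlt
  refine (continuum_le_mk_image_Icc_of_continuousOn hf hfc).not_gt ?_
  set S := (fun t => f t + g t) '' Set.Icc a b
  set C := g '' Set.Icc a b
  have hsub : f '' Set.Icc a b ⊆ (fun p : ℝ × ℝ => p.1 - p.2) '' (S ×ˢ C) := by
    rintro _ ⟨t, ht, rfl⟩
    exact ⟨(f t + g t, g t), ⟨Set.mem_image_of_mem _ ht, Set.mem_image_of_mem _ ht⟩,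
      add_sub_cancel_right _ _⟩
  calc Cardinal.mk (f '' Set.Icc a b)
      ≤ Cardinal.mk ((fun p : ℝ × ℝ => p.1 - p.2) '' (S ×ˢ C)) :=
        Cardinal.mk_le_mk_of_subset hsub
    _ ≤ Cardinal.mk (S ×ˢ C : Set (ℝ × ℝ)) := Cardinal.mk_image_le
    _ = Cardinal.mk S * Cardinal.mk C := Cardinal.mk_setProd S C
    _ < Cardinal.continuum :=
        Cardinal.mul_lt_of_lt Cardinal.aleph0_le_continuum hlt
          (hg.le_aleph0.trans_lt Cardinal.aleph0_lt_continuum)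
end

section
/- Let R be a two-dimensional normed space over 𝔽 ∈ {ℝ, ℂ} in which BJ-orthogonality is symmetric (x ⊥ y implies y ⊥ x for all x, y ∈ R), and let x ∈ R with ‖x‖ = 1 be a nonsmooth point. Then there exists a continuous linear functional f on R with ‖f‖ = 1, f(x) = 0, and x^⊥ = { α z : α ∈ 𝔽, z ∈ R, ‖z‖ ≤ 1, f(z) = 1 }. -/
/-- A nonzero functional on a finite-dimensional space has a scalar multiple of norm one that takes
the value one in the unit ball. -/
theorem exists_smul_norm_eq_one {𝕜 X : Type*} [RCLike 𝕜] [NormedAddCommGroup X] [NormedSpace 𝕜 X]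
    [FiniteDimensional 𝕜 X] (h : X →L[𝕜] 𝕜) (hh : h ≠ 0) :
    ∃ (a : 𝕜) (z : X), ‖a • h‖ = 1 ∧ ‖z‖ ≤ 1 ∧ (a • h) z = 1 := by
  have : ProperSpace X := FiniteDimensional.proper 𝕜 X
  obtain ⟨z, hz, hmax⟩ := (isCompact_closedBall (0 : X) 1).exists_isMaxOn
    ⟨0, by simp⟩ (f := fun w => ‖h w‖) (by fun_prop)
  rw [mem_closedBall_zero_iff] at hz
  have hle : ‖h‖ ≤ ‖h z‖ := by
    let _ : NormedSpace ℝ X := NormedSpace.restrictScalars ℝ 𝕜 X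
    refine h.opNorm_le_of_unit_norm (norm_nonneg _) fun w hw => ?_
    exact hmax (by simp [hw])
  have hhz : h z ≠ 0 := norm_pos_iff.mp ((norm_pos_iff.mpr hh).trans_le hle)
  have heq : ‖h‖ = ‖h z‖ := hle.antisymm <| by
    simpa using h.le_of_opNorm_le_of_le le_rfl hz
  refine ⟨(h z)⁻¹, z, ?_, hz, by simp [hhz]⟩
  rw [norm_smul, norm_inv, heq, inv_mul_cancel₀ (norm_ne_zero_iff.mpr hhz)]

/-- A nonzero functional on a two-dimensional space vanishing at `x ≠ 0` has kernel spanned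
by `x`. -/
theorem exists_eq_smul_of_apply_eq_zero {𝕜 X : Type*} [Field 𝕜] [AddCommGroup X] [Module 𝕜 X]
    (h2 : Module.finrank 𝕜 X = 2) {f : X →ₗ[𝕜] 𝕜} (hf : f ≠ 0) {x y : X} (hx : x ≠ 0)
    (hfx : f x = 0) (hfy : f y = 0) : ∃ c : 𝕜, y = c • x := by
  have : FiniteDimensional 𝕜 X := .of_finrank_pos (by omega)
  have hk : Module.finrank 𝕜 (LinearMap.ker f) = 1 := by
    have := f.finrank_range_add_finrank_ker
    rw [LinearMap.range_eq_top.mpr (LinearMap.surjective hf), finrank_top,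
      Module.finrank_self] at this
    omega
  obtain ⟨c, hc⟩ := (finrank_eq_one_iff_of_nonzero' (⟨x, hfx⟩ : LinearMap.ker f)
    (by simpa [Subtype.ext_iff] using hx)).mp hk ⟨y, hfy⟩
  exact ⟨c, (congrArg Subtype.val hc).symm⟩

/-- A vector of the unit ball at which a norm-one functional `f` takes the value one is BJ-orthogonal
to the kernel of `f`, and so are its multiples. -/
theorem BJOrtho.smul_of_apply_eq_one {𝕜 X : Type*} [RCLike 𝕜] [NormedAddCommGroup X]
    [NormedSpace 𝕜 X] {f : X →L[𝕜] 𝕜} (hf : ‖f‖ = 1) {x z : X} (hfx : f x = 0) (hz : ‖z‖ ≤ 1)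
    (hfz : f z = 1) (a : 𝕜) : BJOrtho 𝕜 (a • z) x := fun c =>
  calc ‖a • z‖ ≤ ‖a‖ := by
        rw [norm_smul]
        exact mul_le_of_le_one_right (norm_nonneg a) hz
    _ = ‖f (a • z + c • x)‖ := by simp [hfx, hfz]
    _ ≤ ‖a • z + c • x‖ := by simpa only [hf, one_mul] using f.le_opNorm (a • z + c • x)

/-- In a two-dimensional normed space with symmetric BJ-orthogonality (a Radon plane), for any
normalized nonsmooth point `x` there is a norm-one functional `f` annihilating `x` with
`x^⊥ = 𝕜 · (f⁻¹(1) ∩ B)`, the scalar multiples of the corresponding exposed face. -/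
theorem stmt15 {𝕜 X : Type*} [RCLike 𝕜] [NormedAddCommGroup X] [NormedSpace 𝕜 X]
    (h2 : Module.finrank 𝕜 X = 2)
    (hsym : ∀ u v : X, BJOrtho 𝕜 u v → BJOrtho 𝕜 v u)
    (x : X) (hx : ‖x‖ = 1)
    (hns : ∃ f g : X →L[𝕜] 𝕜, f ≠ g ∧ IsSuppFun 𝕜 f x ∧ IsSuppFun 𝕜 g x) :
    ∃ f : X →L[𝕜] 𝕜, ‖f‖ = 1 ∧ f x = 0 ∧
      {y : X | BJOrtho 𝕜 x y} =
        {w : X | ∃ (α : 𝕜) (z : X), ‖z‖ ≤ 1 ∧ f z = 1 ∧ w = α • z} := by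
  have : FiniteDimensional 𝕜 X := .of_finrank_pos (by omega)
  obtain ⟨g, k, hgk, ⟨-, hg⟩, -, hk⟩ := hns
  obtain ⟨a, z, hf, hz, hfz⟩ := exists_smul_norm_eq_one (g - k) (sub_ne_zero.mpr hgk)
  have hfx : (a • (g - k)) x = 0 := by simp [hg, hk]
  generalize a • (g - k) = f at hf hfz hfx
  refine ⟨f, hf, hfx, Set.Subset.antisymm (fun y hy => ?_) ?_⟩
  · obtain ⟨c, hc⟩ := exists_eq_smul_of_apply_eq_zero (f := (f : X →ₗ[𝕜] 𝕜)) h2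
      (fun h0 => one_ne_zero (hfz.symm.trans (LinearMap.congr_fun h0 z)))
      (norm_ne_zero_iff.mp (hx ▸ one_ne_zero)) hfx (y := y - f y • z) (by simp [hfz])
    have hle : ‖y‖ ≤ ‖f y‖ := by
      calc ‖y‖ ≤ ‖y + (-c) • x‖ := hsym x y hy (-c)
        _ = ‖f y • z‖ := by rw [neg_smul, ← hc]; congr 1; abel
        _ ≤ ‖f y‖ := by
          rw [norm_smul]
          exact mul_le_of_le_one_right (norm_nonneg _) hz
    by_cases h0 : f y = 0
    · have hy0 : y = 0 := by simpa [h0] using hle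
      exact ⟨0, z, hz, hfz, by simp [hy0]⟩
    · refine ⟨f y, (f y)⁻¹ • y, ?_, by simp [h0], by simp [h0]⟩
      rw [norm_smul, norm_inv]
      exact inv_mul_le_one_of_le₀ hle (norm_nonneg _)
  · rintro _ ⟨b, w, hw, hfw, rfl⟩
    exact hsym _ _ (BJOrtho.smul_of_apply_eq_one hf hfx hw hfw b)
end

section
/- Let X and Y be normed spaces over 𝔽 ∈ {ℝ, ℂ} and let Z = X ⊕₂ Y be their direct sum with the norm ‖(x, y)‖ = √(‖x‖² + ‖y‖²). Then for every nonzero x ∈ X and every (y, z) ∈ Z: (x, 0) ⊥ (y, z) in Z if and only if x ⊥ y in X, and (y, z) ⊥ (x, 0) in Z if and only if y ⊥ x in X; equivalently, (x,0)^⊥ = x^⊥ ⊕ Y and ^⊥(x,0) = ^⊥x ⊕ Y. -/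
/-- Birkhoff–James orthogonality in an `ℓ²`-direct sum, in terms of the norms of the summands. -/
theorem bjOrtho_prod_iff {𝕜 X Y : Type*} [RCLike 𝕜] [NormedAddCommGroup X] [NormedSpace 𝕜 X]
    [NormedAddCommGroup Y] [NormedSpace 𝕜 Y] (x y : X) (u v : Y) :
    BJOrtho 𝕜 ((WithLp.equiv 2 (X × Y)).symm (x, u)) ((WithLp.equiv 2 (X × Y)).symm (y, v)) ↔
      ∀ c : 𝕜, ‖x‖ ^ 2 + ‖u‖ ^ 2 ≤ ‖x + c • y‖ ^ 2 + ‖u + c • v‖ ^ 2 := by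
  refine forall_congr' fun c => ?_
  rw [← sq_le_sq₀ (norm_nonneg _) (norm_nonneg _), WithLp.prod_norm_sq_eq_of_L2,
    WithLp.prod_norm_sq_eq_of_L2]
  rfl

/-- A quadratic perturbation in the scalar does not affect Birkhoff–James orthogonality. -/
theorem BJOrtho.of_sq_le_add_sq {𝕜 X : Type*} [RCLike 𝕜] [NormedAddCommGroup X] [NormedSpace 𝕜 X]
    {x y : X} {r : ℝ} (h : ∀ c : 𝕜, ‖x‖ ^ 2 ≤ ‖x + c • y‖ ^ 2 + (‖c‖ * r) ^ 2) :
    BJOrtho 𝕜 x y := by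
  intro c
  by_contra! hlt
  have hx : 0 < ‖x‖ := (norm_nonneg _).trans_lt hlt
  obtain ⟨δ, hδ⟩ : ∃ δ, δ = ‖x‖ - ‖x + c • y‖ := ⟨_, rfl⟩
  have hδ0 : 0 < δ := by linarith
  have hA : 0 < δ * ‖x‖ := mul_pos hδ0 hx
  have hK : 0 ≤ δ ^ 2 + (‖c‖ * r) ^ 2 := by positivity
  obtain ⟨t, ht⟩ : ∃ t, t = δ * ‖x‖ / (δ * ‖x‖ + (δ ^ 2 + (‖c‖ * r) ^ 2)) := ⟨_, rfl⟩
  have ht0 : 0 < t := by rw [ht]; positivity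
  have ht1 : t ≤ 1 := by rw [ht]; exact div_le_one_of_le₀ (by linarith) (by linarith)
  have hmul : t * (δ * ‖x‖ + (δ ^ 2 + (‖c‖ * r) ^ 2)) = δ * ‖x‖ := by
    rw [ht]; exact div_mul_cancel₀ _ (by positivity)
  have hconv : ‖x + ((t : 𝕜) * c) • y‖ ≤ ‖x‖ - t * δ := by
    have e : x + ((t : 𝕜) * c) • y = ((1 - t : ℝ) : 𝕜) • x + (t : 𝕜) • (x + c • y) := by
      push_cast
      module
    calc ‖x + ((t : 𝕜) * c) • y‖
        ≤ ‖((1 - t : ℝ) : 𝕜) • x‖ + ‖(t : 𝕜) • (x + c • y)‖ := e ▸ norm_add_le _ _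
      _ = (1 - t) * ‖x‖ + t * ‖x + c • y‖ := by
        rw [norm_smul, norm_smul, RCLike.norm_of_nonneg (sub_nonneg.2 ht1),
          RCLike.norm_of_nonneg ht0.le]
      _ = ‖x‖ - t * δ := by rw [hδ]; ring
  have hsq := h ((t : 𝕜) * c)
  rw [norm_mul, RCLike.norm_of_nonneg ht0.le] at hsq
  have hpow : ‖x + ((t : 𝕜) * c) • y‖ ^ 2 ≤ (‖x‖ - t * δ) ^ 2 :=
    pow_le_pow_left₀ (norm_nonneg _) hconv 2
  have hle : 0 ≤ t * (t * (δ ^ 2 + (‖c‖ * r) ^ 2) - 2 * (δ * ‖x‖)) := by linarith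
  have hpos := nonneg_of_mul_nonneg_right hle ht0
  have := mul_pos ht0 hA
  linarith

/-- In the ℓ²-direct sum `Z = X ⊕₂ Y` (with norm `‖(x,y)‖ = √(‖x‖² + ‖y‖²)`), for nonzero
`x ∈ X`: `(x,0) ⊥ (y,z)` iff `x ⊥ y`, and `(y,z) ⊥ (x,0)` iff `y ⊥ x`. -/
theorem stmt16 {𝕜 X Y : Type*} [RCLike 𝕜] [NormedAddCommGroup X] [NormedSpace 𝕜 X]
    [NormedAddCommGroup Y] [NormedSpace 𝕜 Y]
    (x : X) (hx : x ≠ 0) (y : X) (z : Y) :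
    (BJOrtho 𝕜 ((WithLp.equiv 2 (X × Y)).symm (x, 0))
        ((WithLp.equiv 2 (X × Y)).symm (y, z)) ↔ BJOrtho 𝕜 x y) ∧
    (BJOrtho 𝕜 ((WithLp.equiv 2 (X × Y)).symm (y, z))
        ((WithLp.equiv 2 (X × Y)).symm (x, 0)) ↔ BJOrtho 𝕜 y x) := by
  simp only [bjOrtho_prod_iff, norm_zero, zero_add, smul_zero, add_zero, norm_smul,
    add_le_add_iff_right]
  refine ⟨⟨fun h => BJOrtho.of_sq_le_add_sq (r := ‖z‖) fun c => ?_, fun h c => ?_⟩,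
    forall_congr' fun c => sq_le_sq₀ (norm_nonneg _) (norm_nonneg _)⟩
  · simpa using h c
  · have := pow_le_pow_left₀ (norm_nonneg _) (h c) 2
    have := sq_nonneg (‖c‖ * ‖z‖)
    linarith
end

section
/- Let X be a normed space over 𝔽 ∈ {ℝ, ℂ} and let x, y ∈ X be nonzero. Then x^⊥ ⊆ y^⊥ if and only if there exists α ∈ 𝔽 \ {0} such that every supporting functional of αx is a supporting functional of y, i.e., every continuous linear functional f with ‖f‖ = 1 and f(αx) = ‖αx‖ also satisfies f(y) = ‖y‖. -/
section SupportingFunctional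

variable {𝕜 X : Type*} [RCLike 𝕜] [NormedAddCommGroup X] [NormedSpace 𝕜 X]

/-- A functional in the unit ball that attains the norm of a nonzero vector has norm one. -/
lemma norm_eq_one_of_apply_eq_norm {f : X →L[𝕜] 𝕜} {x : X} (hx : x ≠ 0) (hf : ‖f‖ ≤ 1)
    (hfx : f x = (‖x‖ : 𝕜)) : ‖f‖ = 1 := by
  refine le_antisymm hf ?_
  have h := f.le_opNorm x
  rw [hfx, RCLike.norm_ofReal, abs_norm] at h
  exact (le_mul_iff_one_le_left (norm_pos_iff.2 hx)).1 h

/-- By the Hahn–Banach theorem, if `x` is BJ-orthogonal to `w`, some supporting functional of `x`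
vanishes at `w`. -/
lemma BJOrtho.exists_supporting {x w : X} (hx : x ≠ 0) (h : BJOrtho 𝕜 x w) :
    ∃ f : X →L[𝕜] 𝕜, ‖f‖ = 1 ∧ f x = (‖x‖ : 𝕜) ∧ f w = 0 := by
  let S : Submodule 𝕜 X := Submodule.span 𝕜 {w}
  have hnorm : ‖S.mkQ x‖ = ‖x‖ := by
    refine le_antisymm (Submodule.Quotient.norm_mk_le S x) ?_
    refine (QuotientAddGroup.le_norm_iff (S := S.toAddSubgroup)).2 fun m hm ↦ ?_
    obtain ⟨c, hc⟩ := Submodule.mem_span_singleton.1 ((Submodule.Quotient.eq S).1 hm)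
    have := h c
    rwa [hc, add_sub_cancel] at this
  obtain ⟨g, hg, hgx⟩ := exists_dual_vector'' 𝕜 (S.mkQ x)
  have hfx : (g ∘L S.mkQL) x = (‖x‖ : 𝕜) := by
    rw [← hnorm]; exact hgx
  refine ⟨g ∘L S.mkQL, norm_eq_one_of_apply_eq_norm hx ?_ hfx, hfx, ?_⟩
  · refine ContinuousLinearMap.opNorm_le_bound _ zero_le_one fun v ↦ ?_
    calc ‖g (S.mkQ v)‖ ≤ ‖g‖ * ‖S.mkQ v‖ := g.le_opNorm _
      _ ≤ 1 * ‖v‖ := by gcongr; exact Submodule.Quotient.norm_mk_le S v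
  · have : S.mkQ w = 0 :=
      (Submodule.Quotient.mk_eq_zero S).2 (Submodule.mem_span_singleton_self w)
    change g (S.mkQ w) = 0
    rw [this, map_zero]

/-- A vector is BJ-orthogonal to the kernel of each of its supporting functionals. -/
lemma BJOrtho.of_supporting {f : X →L[𝕜] 𝕜} {x w : X} (hf : ‖f‖ ≤ 1)
    (hfx : f x = (‖x‖ : 𝕜)) (hfw : f w = 0) : BJOrtho 𝕜 x w := fun c ↦ by
  have h : f (x + c • w) = (‖x‖ : 𝕜) := by simp [hfx, hfw]
  have h' := f.le_of_opNorm_le hf (x + c • w)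
  rwa [h, RCLike.norm_ofReal, abs_norm, one_mul] at h'

/-- If `x^⊥ ⊆ y^⊥`, supporting functionals of `x` attain, up to a phase, the norm of `y`. -/
lemma norm_apply_eq_of_bjOrtho_imp {x y : X} (hx : x ≠ 0)
    (h : ∀ w, BJOrtho 𝕜 x w → BJOrtho 𝕜 y w) {f : X →L[𝕜] 𝕜} (hf : ‖f‖ ≤ 1)
    (hfx : f x = (‖x‖ : 𝕜)) : ‖f y‖ = ‖y‖ := by
  have hx' : (‖x‖ : 𝕜) ≠ 0 := by simpa using hx
  refine le_antisymm (by simpa using f.le_of_opNorm_le hf y) ?_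
  have hw : f (y - (f y / (‖x‖ : 𝕜)) • x) = 0 := by simp [hfx, hx']
  have hle := h _ (.of_supporting hf hfx hw) (-1)
  have heq : y + (-1 : 𝕜) • (y - (f y / (‖x‖ : 𝕜)) • x) = (f y / (‖x‖ : 𝕜)) • x := by
    rw [neg_one_smul]; abel
  rwa [heq, norm_smul, norm_div, RCLike.norm_ofReal, abs_norm,
    div_mul_cancel₀ _ (norm_ne_zero_iff.2 hx)] at hle

/-- If `x^⊥ ⊆ y^⊥`, all supporting functionals of `x` take the same value at `y`. -/
lemma apply_eq_apply_of_bjOrtho_imp {x y : X} (hx : x ≠ 0)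
    (h : ∀ w, BJOrtho 𝕜 x w → BJOrtho 𝕜 y w) {f g : X →L[𝕜] 𝕜} (hf : ‖f‖ ≤ 1)
    (hfx : f x = (‖x‖ : 𝕜)) (hg : ‖g‖ ≤ 1) (hgx : g x = (‖x‖ : 𝕜)) : f y = g y := by
  have hmid : ‖(2⁻¹ : 𝕜) • (f + g)‖ ≤ 1 := by
    rw [norm_smul, norm_inv, RCLike.norm_ofNat]
    linarith [norm_add_le f g]
  have hmidx : ((2⁻¹ : 𝕜) • (f + g)) x = (‖x‖ : 𝕜) := by
    simp only [smul_apply, add_apply, hfx, hgx, smul_eq_mul]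
    ring
  have hsum : ‖f y + g y‖ = 2 * ‖y‖ := by
    have := norm_apply_eq_of_bjOrtho_imp hx h hmid hmidx
    simp only [smul_apply, add_apply, norm_smul, norm_inv, RCLike.norm_ofNat] at this
    linarith
  have hpar := parallelogram_law_with_norm 𝕜 (f y) (g y)
  rw [hsum, norm_apply_eq_of_bjOrtho_imp hx h hf hfx,
    norm_apply_eq_of_bjOrtho_imp hx h hg hgx] at hpar
  have : ‖f y - g y‖ ^ 2 = 0 := by linarith
  exact sub_eq_zero.1 (norm_eq_zero.1 (pow_eq_zero_iff two_ne_zero |>.1 this))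

end SupportingFunctional

/-- For nonzero `x, y`: `x^⊥ ⊆ y^⊥` iff there is a nonzero scalar `α` such that every
supporting functional of `α • x` is a supporting functional of `y`. -/
theorem stmt17 {𝕜 X : Type*} [RCLike 𝕜] [NormedAddCommGroup X] [NormedSpace 𝕜 X]
    (x y : X) (hx : x ≠ 0) (hy : y ≠ 0) :
    {w : X | BJOrtho 𝕜 x w} ⊆ {w : X | BJOrtho 𝕜 y w} ↔
    ∃ α : 𝕜, α ≠ 0 ∧ ∀ f : X →L[𝕜] 𝕜,
      (‖f‖ = 1 ∧ f (α • x) = (‖α • x‖ : 𝕜)) → f y = (‖y‖ : 𝕜) := by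
  refine ⟨fun h ↦ ?_, ?_⟩
  · have hsub : ∀ w, BJOrtho 𝕜 x w → BJOrtho 𝕜 y w := fun w hw ↦ h hw
    obtain ⟨f₀, hf₀, hf₀x⟩ := exists_dual_vector 𝕜 x (norm_ne_zero_iff.2 hx)
    have hf₀y := norm_apply_eq_of_bjOrtho_imp hx hsub hf₀.le hf₀x
    have hy' : (‖y‖ : 𝕜) ≠ 0 := by simpa using hy
    have hα : ‖f₀ y / (‖y‖ : 𝕜)‖ = 1 := by
      rw [norm_div, hf₀y, RCLike.norm_ofReal, abs_norm, div_self (norm_ne_zero_iff.2 hy)]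
    have hα0 : f₀ y / (‖y‖ : 𝕜) ≠ 0 := norm_ne_zero_iff.1 (by rw [hα]; exact one_ne_zero)
    refine ⟨f₀ y / (‖y‖ : 𝕜), hα0, fun f ⟨hf, hfx⟩ ↦ mul_left_cancel₀ hα0 ?_⟩
    rw [map_smul, norm_smul, hα, one_mul] at hfx
    rw [div_mul_cancel₀ _ hy']
    refine apply_eq_apply_of_bjOrtho_imp (f := (f₀ y / (‖y‖ : 𝕜)) • f) hx hsub ?_ hfx
      hf₀.le hf₀x
    rw [norm_smul, hα, hf, one_mul]
  · rintro ⟨α, hα, h⟩ w hw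
    have hw' : BJOrtho 𝕜 (α • x) w := fun c ↦ by
      have hle := hw (α⁻¹ * c)
      have heq : α • x + c • w = α • (x + (α⁻¹ * c) • w) := by
        rw [smul_add, smul_smul, mul_inv_cancel_left₀ hα]
      rw [heq, norm_smul, norm_smul]
      gcongr
    obtain ⟨f, hf, hfx, hfw⟩ := hw'.exists_supporting (smul_ne_zero hα hx)
    exact .of_supporting hf.le (h f ⟨hf, hfx⟩) hfw
end

section
/- Let X be a finite-dimensional real normed space. Then the norm on X is polyhedral (its closed unit ball is an intersection of finitely many closed half-spaces, i.e., there exist finitely many linear functionals f₁, …, f_m with { x : ‖x‖ ≤ 1 } = { x : f_i(x) ≤ 1 for all i }) if and only if the family of sets { x^⊥ : x ∈ X \ {0} } is finite. -/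
open Filter Topology in
/-- A norm whose unit ball is cut out by finitely many functionals is attained by one of them at
each nonzero vector. -/
theorem exists_eq_norm_of_unitBall_eq {X : Type*} [NormedAddCommGroup X] [NormedSpace ℝ X]
    {ι : Type*} [Finite ι] {f : ι → X →ₗ[ℝ] ℝ}
    (hf : ∀ (z : X) (r : ℝ), 0 < r → (‖z‖ ≤ r ↔ ∀ i, f i z ≤ r)) {z : X} (hz : z ≠ 0) :
    ∃ i, f i z = ‖z‖ := by
  have hpos : 0 < ‖z‖ := norm_pos_iff.mpr hz
  have hle := (hf z ‖z‖ hpos).1 le_rfl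
  by_contra! hne
  have hev : ∀ᶠ r in 𝓝[<] ‖z‖, (∀ i, f i z ≤ r) ∧ 0 < r := by
    refine (eventually_all.2 fun i => ?_).and ?_
    · exact nhdsWithin_le_nhds (eventually_ge_nhds (lt_of_le_of_ne (hle i) (hne i)))
    · exact nhdsWithin_le_nhds (eventually_gt_nhds hpos)
  obtain ⟨r, ⟨h1, h2⟩, h3⟩ := (hev.and self_mem_nhdsWithin).exists
  exact absurd ((hf z r h2).2 h1) (not_le.2 h3)

open Filter Topology in
/-- If all functionals active at `x` are negative at `y`, moving from `x` towards `y` decreases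
the norm. -/
theorem exists_norm_add_smul_lt {X : Type*} [NormedAddCommGroup X] [NormedSpace ℝ X]
    {ι : Type*} [Finite ι] {f : ι → X →ₗ[ℝ] ℝ}
    (hf : ∀ (z : X) (r : ℝ), 0 < r → (‖z‖ ≤ r ↔ ∀ i, f i z ≤ r)) {x y : X} (hx : x ≠ 0)
    (hy : ∀ i, f i x = ‖x‖ → f i y < 0) :
    ∃ c : ℝ, ‖x + c • y‖ < ‖x‖ := by
  have hpos : 0 < ‖x‖ := norm_pos_iff.mpr hx
  have hle := (hf x ‖x‖ hpos).1 le_rfl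
  have hev : ∀ᶠ c : ℝ in 𝓝[>] 0, ∀ i, f i (x + c • y) < ‖x‖ := by
    refine eventually_all.2 fun i => ?_
    rcases (hle i).eq_or_lt with h | h
    · filter_upwards [self_mem_nhdsWithin] with c hc
      have := mul_neg_of_pos_of_neg (Set.mem_Ioi.1 hc) (hy i h)
      simp only [map_add, map_smul, smul_eq_mul]
      linarith
    · refine nhdsWithin_le_nhds ?_
      have hcont : Continuous fun c : ℝ => f i (x + c • y) := by
        simp only [map_add, map_smul, smul_eq_mul]
        fun_prop
      exact hcont.continuousAt.eventually_lt continuousAt_const (by simpa using h)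
  obtain ⟨c, hc⟩ := hev.exists
  refine ⟨c, ?_⟩
  rcases eq_or_ne (x + c • y) 0 with h0 | h0
  · simpa [h0] using hx
  · obtain ⟨i, hi⟩ := exists_eq_norm_of_unitBall_eq hf h0
    exact hi ▸ hc i

/-- For a polyhedral norm, orthogonality at `x` is decided by the signs of the active
functionals. -/
theorem bjOrtho_iff_of_unitBall_eq {X : Type*} [NormedAddCommGroup X] [NormedSpace ℝ X]
    {ι : Type*} [Finite ι] {f : ι → X →ₗ[ℝ] ℝ}
    (hf : ∀ (z : X) (r : ℝ), 0 < r → (‖z‖ ≤ r ↔ ∀ i, f i z ≤ r)) {x : X} (hx : x ≠ 0) (y : X) :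
    BJOrtho ℝ x y ↔ (∃ i, f i x = ‖x‖ ∧ 0 ≤ f i y) ∧ ∃ i, f i x = ‖x‖ ∧ f i y ≤ 0 := by
  have hle : ∀ i z, f i z ≤ ‖z‖ := by
    intro i z
    rcases eq_or_ne z 0 with rfl | hz
    · simp
    · exact (hf z ‖z‖ (norm_pos_iff.mpr hz)).1 le_rfl i
  constructor
  · intro h
    constructor
    · by_contra! hneg
      obtain ⟨c, hc⟩ := exists_norm_add_smul_lt hf hx hneg
      exact absurd (h c) (not_le.2 hc)
    · by_contra! hneg
      obtain ⟨c, hc⟩ := exists_norm_add_smul_lt (y := -y) hf hx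
        fun i hi => by simpa using hneg i hi
      exact absurd (h (-c)) (not_le.2 (by simpa using hc))
  · rintro ⟨⟨i, hi, hiy⟩, j, hj, hjy⟩ c
    rcases le_total 0 c with hc | hc
    · have h1 := hle i (x + c • y)
      simp only [map_add, map_smul, smul_eq_mul] at h1
      nlinarith [mul_nonneg hc hiy]
    · have h1 := hle j (x + c • y)
      simp only [map_add, map_smul, smul_eq_mul] at h1
      nlinarith [mul_nonneg_of_nonpos_of_nonpos hc hjy]

/-- A polyhedral norm has finitely many orthogonality sets. -/
theorem finite_bjOrtho_of_unitBall_eq {X : Type*} [NormedAddCommGroup X] [NormedSpace ℝ X]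
    {ι : Type*} [Finite ι] {f : ι → X →ₗ[ℝ] ℝ}
    (hf : {x : X | ‖x‖ ≤ 1} = {x : X | ∀ i, f i x ≤ 1}) :
    {S : Set X | ∃ x : X, x ≠ 0 ∧ S = {y : X | BJOrtho ℝ x y}}.Finite := by
  have hf' : ∀ (z : X) (r : ℝ), 0 < r → (‖z‖ ≤ r ↔ ∀ i, f i z ≤ r) := by
    intro z r hr
    have h := Set.ext_iff.1 hf (r⁻¹ • z)
    simpa [norm_smul, abs_of_pos hr, inv_mul_le_iff₀ hr] using h
  refine (Set.finite_range fun A : Set ι =>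
    {y : X | (∃ i ∈ A, 0 ≤ f i y) ∧ ∃ i ∈ A, f i y ≤ 0}).subset ?_
  rintro S ⟨x, hx, rfl⟩
  refine ⟨{i | f i x = ‖x‖}, ?_⟩
  ext y
  exact (bjOrtho_iff_of_unitBall_eq hf' hx y).symm

/-- At a point of differentiability of the norm, orthogonality is given by the kernel of the
derivative. -/
theorem bjOrtho_iff_fderiv_norm_eq_zero {X : Type*} [NormedAddCommGroup X] [NormedSpace ℝ X]
    {x : X} (hd : DifferentiableAt ℝ (fun z : X => ‖z‖) x) (y : X) :
    BJOrtho ℝ x y ↔ fderiv ℝ (fun z : X => ‖z‖) x y = 0 := by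
  constructor
  · intro h
    have h0 : HasDerivAt (fun c : ℝ => x + c • y) y 0 := by
      simpa using ((hasDerivAt_id (0 : ℝ)).smul_const y).const_add x
    have hF : HasFDerivAt (fun z : X => ‖z‖) (fderiv ℝ (fun z : X => ‖z‖) x)
        (x + (0 : ℝ) • y) := by
      simpa using hd.hasFDerivAt
    have hmin : IsLocalMin ((fun z : X => ‖z‖) ∘ fun c : ℝ => x + c • y) 0 :=
      Filter.Eventually.of_forall fun c => by simpa using h c
    exact hmin.hasDerivAt_eq_zero (hF.comp_hasDerivAt 0 h0)
  · intro h c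
    have hlip : ‖fderiv ℝ (fun z : X => ‖z‖) x‖ ≤ 1 := by
      simpa using norm_fderiv_le_of_lipschitz ℝ (x₀ := x) (lipschitzWith_one_norm (E := X))
    calc ‖x‖ = fderiv ℝ (fun z : X => ‖z‖) x (x + c • y) := by
          simp [h, hd.fderiv_norm_self]
      _ ≤ ‖fderiv ℝ (fun z : X => ‖z‖) x (x + c • y)‖ := le_abs_self _
      _ ≤ ‖x + c • y‖ := by simpa using ContinuousLinearMap.le_of_opNorm_le _ hlip (x + c • y)

/-- Norm-one functionals with a common kernel agree up to sign. -/
theorem eq_or_eq_neg_of_ker_eq {X : Type*} [NormedAddCommGroup X] [NormedSpace ℝ X]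
    {f g : X →L[ℝ] ℝ} (hf : ‖f‖ = 1) (hg : ‖g‖ = 1)
    (h : {y : X | f y = 0} = {y : X | g y = 0}) : g = f ∨ g = -f := by
  obtain ⟨x, hx⟩ : ∃ x, f x ≠ 0 := by
    by_contra! h0
    have : f = 0 := ContinuousLinearMap.ext h0
    simp [this] at hf
  have hgf : g = (g x / f x) • f := by
    ext v
    have hv : v - (f v / f x) • x ∈ {y : X | f y = 0} := by simp [hx]
    rw [h] at hv
    simp only [Set.mem_ofPred_eq, map_sub, map_smul, smul_eq_mul] at hv
    simp only [smul_apply, smul_eq_mul]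
    rw [sub_eq_zero.1 hv]
    ring
  have habs : |g x / f x| = 1 := by
    have := congrArg norm hgf
    rw [norm_smul, hf, hg, Real.norm_eq_abs] at this
    linarith
  rcases eq_or_eq_neg_of_abs_eq habs with h1 | h1 <;> rw [h1] at hgf
  · exact Or.inl (by simpa using hgf)
  · exact Or.inr (hgf.trans (ContinuousLinearMap.ext fun v => by simp))

/-- Finitely many orthogonality sets yield finitely many derivatives of the norm. -/
theorem finite_fderiv_norm {X : Type*} [NormedAddCommGroup X] [NormedSpace ℝ X]
    (h : {S : Set X | ∃ x : X, x ≠ 0 ∧ S = {y : X | BJOrtho ℝ x y}}.Finite) :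
    {g : X →L[ℝ] ℝ | ∃ x : X, x ≠ 0 ∧ DifferentiableAt ℝ (fun z : X => ‖z‖) x ∧
      g = fderiv ℝ (fun z : X => ‖z‖) x}.Finite := by
  have hnorm : ∀ x : X, x ≠ 0 → DifferentiableAt ℝ (fun z : X => ‖z‖) x →
      ‖fderiv ℝ (fun z : X => ‖z‖) x‖ = 1 := by
    intro x hx hd
    have : Nontrivial X := ⟨x, 0, hx⟩
    exact norm_fderiv_norm hd
  refine Set.Finite.of_finite_fibers (fun g : X →L[ℝ] ℝ => {y : X | g y = 0})
    (h.subset ?_) ?_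
  · rintro _ ⟨_, ⟨x, hx, hd, rfl⟩, rfl⟩
    refine ⟨x, hx, ?_⟩
    ext y
    exact (bjOrtho_iff_fderiv_norm_eq_zero hd y).symm
  · rintro _ ⟨_, ⟨x, hx, hd, rfl⟩, rfl⟩
    refine (Set.toFinite {fderiv ℝ (fun z : X => ‖z‖) x,
      -fderiv ℝ (fun z : X => ‖z‖) x}).subset ?_
    rintro _ ⟨⟨z, hz, hdz, rfl⟩, hker⟩
    exact eq_or_eq_neg_of_ker_eq (hnorm x hx hd) (hnorm z hz hdz) hker.symm

/-- The unit ball is cut out by the derivatives of the norm once these are finitely many. -/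
theorem unitBall_eq_of_finite_fderiv_norm {X : Type*} [NormedAddCommGroup X] [NormedSpace ℝ X]
    [FiniteDimensional ℝ X] {D : Set (X →L[ℝ] ℝ)}
    (hD : D = {g : X →L[ℝ] ℝ | ∃ x : X, x ≠ 0 ∧ DifferentiableAt ℝ (fun z : X => ‖z‖) x ∧
      g = fderiv ℝ (fun z : X => ‖z‖) x}) (hfin : D.Finite) :
    {x : X | ‖x‖ ≤ 1} = {x : X | ∀ g ∈ D, g x ≤ 1} := by
  have hclosed : IsClosed ({0} ∪ ⋃ g ∈ D, {x : X | ‖x‖ ≤ g x}) :=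
    isClosed_singleton.union
      (hfin.isClosed_biUnion fun g _ => isClosed_le continuous_norm g.continuous)
  have hsub : {x : X | DifferentiableAt ℝ (fun z : X => ‖z‖) x} ⊆
      {0} ∪ ⋃ g ∈ D, {x : X | ‖x‖ ≤ g x} := by
    intro x hd
    rcases eq_or_ne x 0 with rfl | hx
    · exact Or.inl rfl
    · refine Or.inr (Set.mem_biUnion (x := fderiv ℝ (fun z : X => ‖z‖) x) ?_ ?_)
      · rw [hD]
        exact ⟨x, hx, hd, rfl⟩
      · exact (hd.fderiv_norm_self).ge
  ext x
  constructor
  · intro hx g hg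
    rw [hD] at hg
    obtain ⟨z, -, -, rfl⟩ := hg
    have hlip : ‖fderiv ℝ (fun z : X => ‖z‖) z‖ ≤ 1 := by
      simpa using norm_fderiv_le_of_lipschitz ℝ (x₀ := z) (lipschitzWith_one_norm (E := X))
    have hle := ContinuousLinearMap.le_of_opNorm_le _ hlip x
    rw [one_mul] at hle
    exact (le_abs_self _).trans (hle.trans hx)
  · intro hx
    have hmem : x ∈ {0} ∪ ⋃ g ∈ D, {x : X | ‖x‖ ≤ g x} :=
      hclosed.closure_subset_iff.2 hsub (dense_differentiableAt_norm (E := X) x)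
    rcases hmem with h0 | hmem
    · simp [Set.mem_singleton_iff.1 h0]
    · obtain ⟨g, hg, hgx⟩ := Set.mem_iUnion₂.1 hmem
      exact le_trans hgx (hx g hg)

/-- A finite-dimensional real normed space has a polyhedral norm (its closed unit ball is an
intersection of finitely many closed half-spaces) iff the family `{x^⊥ : x ≠ 0}` is finite. -/
theorem stmt18 {X : Type*} [NormedAddCommGroup X] [NormedSpace ℝ X]
    [FiniteDimensional ℝ X] :
    (∃ (m : ℕ) (f : Fin m → (X →ₗ[ℝ] ℝ)),
      {x : X | ‖x‖ ≤ 1} = {x : X | ∀ i, f i x ≤ 1}) ↔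
    {S : Set X | ∃ x : X, x ≠ 0 ∧ S = {y : X | BJOrtho ℝ x y}}.Finite := by
  constructor
  · rintro ⟨m, f, hf⟩
    exact finite_bjOrtho_of_unitBall_eq hf
  · intro h
    have hfin := finite_fderiv_norm h
    obtain ⟨m, f, hf⟩ := hfin.fin_embedding
    refine ⟨m, fun i => (f i : X →ₗ[ℝ] ℝ), ?_⟩
    rw [unitBall_eq_of_finite_fderiv_norm rfl hfin, ← hf]
    simp
end

section
/- Let X be a finite-dimensional real normed space and let F be a maximal face of the closed unit ball of X, i.e., F is a nonempty convex subset of the unit sphere such that whenever an open segment between two points of the closed unit ball meets F both endpoints lie in F, and F is not properly contained in any other such face. Then F is exposed: there exists a continuous linear functional f on X with ‖f‖ = 1 and F = { x ∈ X : ‖x‖ ≤ 1 and f(x) = 1 }. -/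
/-- A face of the closed unit ball of a real normed space: a convex subset of the unit sphere
such that whenever the open segment between two points of the closed unit ball meets it, both
endpoints belong to it. -/
def IsFaceOfBall {X : Type*} [NormedAddCommGroup X] [NormedSpace ℝ X] (F : Set X) : Prop :=
  F ⊆ {x : X | ‖x‖ = 1} ∧ Convex ℝ F ∧
  ∀ u v : X, ‖u‖ ≤ 1 → ‖v‖ ≤ 1 →
    (∃ t : ℝ, 0 < t ∧ t < 1 ∧ t • u + (1 - t) • v ∈ F) → u ∈ F ∧ v ∈ F

/-- A convex set disjoint from the open unit ball is separated from it by a continuous linear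
functional of norm at most one. -/
theorem exists_norm_le_one_of_convex_of_one_le_norm {X : Type*} [NormedAddCommGroup X]
    [NormedSpace ℝ X] {F : Set X} (hF : Convex ℝ F) (h1 : ∀ x ∈ F, 1 ≤ ‖x‖) :
    ∃ f : X →L[ℝ] ℝ, ‖f‖ ≤ 1 ∧ ∀ x ∈ F, 1 ≤ f x := by
  have hdisj : Disjoint (Metric.ball (0 : X) 1) F := by
    rw [Set.disjoint_left]
    intro x hx hxF
    exact absurd (h1 x hxF) (not_le.mpr (by simpa using hx))
  obtain ⟨g, u, hball, hu⟩ :=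
    geometric_hahn_banach_open (convex_ball (0 : X) 1) Metric.isOpen_ball hF hdisj
  have hu0 : 0 < u := by simpa using hball 0 (by simp)
  have hle (x : X) : g x ≤ u * ‖x‖ := by
    have hr (r : ℝ) (hr : ‖x‖ < r) : g x ≤ u * r := by
      have hr0 : 0 < r := (norm_nonneg x).trans_lt hr
      have h := hball (r⁻¹ • x) (by
        rw [mem_ball_zero_iff, norm_smul, norm_inv, Real.norm_of_nonneg hr0.le,
          inv_mul_lt_iff₀ hr0, mul_one]
        exact hr)
      rw [map_smul, smul_eq_mul, inv_mul_lt_iff₀ hr0] at h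
      linarith
    rw [← div_le_iff₀' hu0]
    refine le_of_forall_gt_imp_ge_of_dense fun r hxr => ?_
    rw [div_le_iff₀' hu0]
    exact hr r hxr
  refine ⟨u⁻¹ • g, ContinuousLinearMap.opNorm_le_bound _ zero_le_one fun x => ?_, fun x hx => ?_⟩
  · have hneg := hle (-x)
    rw [map_neg, norm_neg] at hneg
    rw [smul_apply, norm_smul, norm_inv, Real.norm_of_nonneg hu0.le, one_mul,
      inv_mul_le_iff₀ hu0, Real.norm_eq_abs]
    exact abs_le.mpr ⟨by linarith, hle x⟩
  · rw [smul_apply, smul_eq_mul, le_inv_mul_iff₀ hu0, mul_one]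
    exact hu x hx

/-- A continuous linear functional of norm at most one bounds the closed unit ball by `1`. -/
theorem apply_le_one_of_norm_le_one {X : Type*} [NormedAddCommGroup X] [NormedSpace ℝ X]
    {f : X →L[ℝ] ℝ} (hf : ‖f‖ ≤ 1) {x : X} (hx : ‖x‖ ≤ 1) : f x ≤ 1 :=
  (le_abs_self _).trans ((f.le_of_opNorm_le_of_le hf hx).trans_eq (one_mul 1))

/-- The set where a functional of norm at most one attains the value `1` on the closed unit ball is
a face. -/
theorem isFaceOfBall_setOf_apply_eq_one {X : Type*} [NormedAddCommGroup X] [NormedSpace ℝ X]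
    {f : X →L[ℝ] ℝ} (hf : ‖f‖ ≤ 1) : IsFaceOfBall {x : X | ‖x‖ ≤ 1 ∧ f x = 1} := by
  refine ⟨fun x ⟨hx, hfx⟩ => le_antisymm hx ?_, ?_, ?_⟩
  · have h := f.le_of_opNorm_le hf x
    rwa [hfx, norm_one, one_mul] at h
  · have hball : Convex ℝ {x : X | ‖x‖ ≤ 1} := by
      simpa [Metric.closedBall] using convex_closedBall (0 : X) 1
    exact hball.inter (convex_hyperplane f.toLinearMap.isLinear 1)
  · rintro u v hu hv ⟨t, ht0, ht1, -, hft⟩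
    have hfu := apply_le_one_of_norm_le_one hf hu
    have hfv := apply_le_one_of_norm_le_one hf hv
    simp only [map_add, map_smul, smul_eq_mul] at hft
    exact ⟨⟨hu, by nlinarith⟩, ⟨hv, by nlinarith⟩⟩

/-- In a finite-dimensional real normed space, every maximal face of the closed unit ball is
exposed: it is cut out by a norm-one continuous linear functional. -/
theorem stmt19 {X : Type*} [NormedAddCommGroup X] [NormedSpace ℝ X] [FiniteDimensional ℝ X]
    (F : Set X) (hne : F.Nonempty) (hF : IsFaceOfBall F)
    (hmax : ∀ G : Set X, IsFaceOfBall G → F ⊆ G → F = G) :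
    ∃ f : X →L[ℝ] ℝ, ‖f‖ = 1 ∧ F = {x : X | ‖x‖ ≤ 1 ∧ f x = 1} := by
  have hnorm (x : X) (hx : x ∈ F) : ‖x‖ = 1 := hF.1 hx
  obtain ⟨f, hf, hfF⟩ :=
    exists_norm_le_one_of_convex_of_one_le_norm hF.2.1 fun x hx => (hnorm x hx).ge
  refine ⟨f, le_antisymm hf ?_, hmax _ (isFaceOfBall_setOf_apply_eq_one hf) fun x hx =>
    ⟨(hnorm x hx).le, (apply_le_one_of_norm_le_one hf (hnorm x hx).le).antisymm (hfF x hx)⟩⟩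
  obtain ⟨x, hx⟩ := hne
  have h := (le_abs_self _).trans (f.le_opNorm x)
  rw [hnorm x hx, mul_one] at h
  exact (hfF x hx).trans h
end
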